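/- arXiv:0810.4220 — 2 statements merged into one kernel-verified Lean document; each statement's English description precedes it below -/
import Mathlib

section
/- Theta transformation formula: for every ε > 0, real r > 0 and v ∈ ℂ, with x = e^{−ε}, one has ϑ[1/2; −1/2](v/r; π√−1/(εr)) = √(εr/π) · exp(−εr/4) · [v], where [v] = x^{v²/r − v} Θ_{x^{2r}}(x^{2v}). -/
noncomputable section

/-- The q-Pochhammer infinite product `(z; q)_∞ = ∏_{k ≥ 0} (1 - z q^k)`. -/
def qPochC (z q : ℂ) : ℂ := ∏' k : ℕ, (1 - z * q ^ k)

/-- `Θ_q(z) = (z;q)_∞ (q z⁻¹;q)_∞ (q;q)_∞`. -/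
def thetaC (q z : ℂ) : ℂ := qPochC z q * qPochC (q * z⁻¹) q * qPochC q q

/-- Jacobi theta function with characteristics `a`, `b`:
`ϑ[a;b](v;τ) = Σ_{m∈ℤ} exp(π√-1 (m+a)((m+a)τ + 2(v+b)))`. -/
def jTheta (a b : ℝ) (v τ : ℂ) : ℂ :=
  ∑' m : ℤ, Complex.exp ((Real.pi : ℂ) * Complex.I * ((m : ℂ) + (a : ℂ)) *
    (((m : ℂ) + (a : ℂ)) * τ + 2 * (v + (b : ℂ))))

/-- The elliptic symbol `[v] = x^(v²/r - v) Θ_{x^{2r}}(x^{2v})`. -/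
def ebrk (x r : ℝ) (v : ℂ) : ℂ :=
  (x : ℂ) ^ (v ^ 2 / (r : ℂ) - v) * thetaC ((x : ℂ) ^ (((2 * r : ℝ)) : ℂ)) ((x : ℂ) ^ (2 * v))

/-- Partial products of `(Q;Q)_∞`. -/
def auxP (Q : ℂ) (k : ℕ) : ℂ := ∏ j ∈ Finset.range k, (1 - Q * Q ^ j)

/-- Reciprocal of the partial products, extended by zero to negative integers. -/
def auxR (Q : ℂ) (n : ℤ) : ℂ := if 0 ≤ n then (auxP Q n.toNat)⁻¹ else 0

lemma aux_summable (Q z : ℂ) (hQ : ‖Q‖ < 1) : Summable (fun k : ℕ => ‖-(z * Q ^ k)‖) := by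
  simp only [norm_neg, norm_mul, norm_pow]
  exact (summable_geometric_of_lt_one (norm_nonneg _) hQ).mul_left _

lemma aux_tendsto (Q z : ℂ) (hQ : ‖Q‖ < 1) :
    Filter.Tendsto (fun N : ℕ => ∏ k ∈ Finset.range N, (1 - z * Q ^ k)) Filter.atTop
      (nhds (qPochC z Q)) := by
  have h := (multipliable_one_add_of_summable (aux_summable Q z hQ)).hasProd.tendsto_prod_nat
  simpa only [← sub_eq_add_neg, qPochC] using h

lemma aux_factor (Q : ℂ) (hQ : ‖Q‖ < 1) (j : ℕ) : 1 - Q * Q ^ j ≠ 0 := by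
  intro h
  have h1 : Q ^ (j + 1) = 1 := by rw [pow_succ']; exact (sub_eq_zero.mp h).symm
  have h2 : ‖Q‖ ^ (j + 1) < 1 := pow_lt_one₀ (norm_nonneg _) hQ (by omega)
  rw [← norm_pow, h1, norm_one] at h2
  exact lt_irrefl _ h2

lemma auxP_ne (Q : ℂ) (hQ : ‖Q‖ < 1) (k : ℕ) : auxP Q k ≠ 0 :=
  Finset.prod_ne_zero_iff.mpr fun j _ => aux_factor Q hQ j

lemma aux_ne (Q : ℂ) (hQ : ‖Q‖ < 1) : qPochC Q Q ≠ 0 := by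
  have := tprod_one_add_ne_zero_of_summable (f := fun k : ℕ => -(Q * Q ^ k))
    (fun i => by simpa only [← sub_eq_add_neg] using aux_factor Q hQ i)
    (aux_summable Q Q hQ)
  simpa only [← sub_eq_add_neg, qPochC] using this

lemma auxP_tendsto (Q : ℂ) (hQ : ‖Q‖ < 1) :
    Filter.Tendsto (auxP Q) Filter.atTop (nhds (qPochC Q Q)) := aux_tendsto Q Q hQ

lemma auxR_tendsto (Q : ℂ) (hQ : ‖Q‖ < 1) :
    Filter.Tendsto (auxR Q) Filter.atTop (nhds (qPochC Q Q)⁻¹) := by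
  have h1 : Filter.Tendsto Int.toNat Filter.atTop Filter.atTop := by
    refine Filter.tendsto_atTop.mpr fun b => ?_
    filter_upwards [Filter.eventually_ge_atTop (b : ℤ)] with a ha
    omega
  have h := ((auxP_tendsto Q hQ).inv₀ (aux_ne Q hQ)).comp h1
  refine h.congr' ?_
  filter_upwards [Filter.eventually_ge_atTop (0 : ℤ)] with a ha
  simp [auxR, ha]

lemma auxR_bound (Q : ℂ) (hQ : ‖Q‖ < 1) : ∃ C : ℝ, 0 ≤ C ∧ ∀ n, ‖auxR Q n‖ ≤ C := by
  have h := ((auxP_tendsto Q hQ).inv₀ (aux_ne Q hQ)).norm.bddAbove_range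
  obtain ⟨C, hC⟩ := h
  have hC' : ∀ k : ℕ, ‖(auxP Q k)⁻¹‖ ≤ C := fun k => hC ⟨k, rfl⟩
  have h0 : 0 ≤ C := (norm_nonneg _).trans (hC' 0)
  refine ⟨C, h0, fun n => ?_⟩
  unfold auxR
  split_ifs
  · exact hC' _
  · simpa using h0

lemma auxR_rec (Q : ℂ) (hQ : ‖Q‖ < 1) (n : ℤ) : auxR Q (n - 1) = (1 - Q ^ n) * auxR Q n := by
  rcases lt_trichotomy n 0 with h | h | h
  · simp [auxR, show ¬ (0 ≤ n) by omega, show ¬ (1 ≤ n) by omega]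
  · subst h; simp [auxR]
  · obtain ⟨k, rfl⟩ : ∃ k : ℕ, n = k + 1 := ⟨(n - 1).toNat, by omega⟩
    have h1 : (0 : ℤ) ≤ (k : ℤ) + 1 := by omega
    have e : ((k : ℤ) + 1).toNat = k + 1 := by omega
    have hf := aux_factor Q hQ k
    have hz : Q ^ ((k : ℤ) + 1) = Q * Q ^ k := by
      rw [← pow_succ']; exact_mod_cast zpow_natCast Q (k + 1)
    have hp := auxP_ne Q hQ k
    rw [add_sub_cancel_right, auxR, auxR, if_pos (by omega), if_pos h1, e, hz, Int.toNat_natCast]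
    rw [show auxP Q (k + 1) = auxP Q k * (1 - Q * Q ^ k) from Finset.prod_range_succ _ _]
    field_simp

lemma aux_coeff (Q : ℂ) (hQ : ‖Q‖ < 1) (hQ0 : Q ≠ 0) (a b : ℤ) :
    (1 - Q ^ (a + b - 1)) * (1 - Q ^ (a + b)) * (auxR Q a * auxR Q b) =
      (1 + Q ^ (a + b - 1)) * (auxR Q (a - 1) * auxR Q (b - 1)) +
      Q ^ a * (auxR Q a * auxR Q (b - 2)) + Q ^ b * (auxR Q (a - 2) * auxR Q b) := by
  have ha := auxR_rec Q hQ a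
  have hb := auxR_rec Q hQ b
  have ha2 := auxR_rec Q hQ (a - 1)
  have hb2 := auxR_rec Q hQ (b - 1)
  rw [show a - 1 - 1 = a - 2 by ring] at ha2
  rw [show b - 1 - 1 = b - 2 by ring] at hb2
  rw [ha2, hb2, ha, hb, zpow_sub_one₀ hQ0, zpow_sub_one₀ hQ0, zpow_sub_one₀ hQ0, zpow_add₀ hQ0]
  field_simp
  ring

lemma hasSum_congr_aux {f g : ℤ → ℂ} {a b : ℂ} (h : HasSum f a) (hf : ∀ n, g n = f n)
    (hab : b = a) : HasSum g b := by
  obtain rfl : g = f := funext hf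
  rw [hab]; exact h

lemma aux_finite (Q z : ℂ) (hQ : ‖Q‖ < 1) (hQ0 : Q ≠ 0) (hz : z ≠ 0) (t : ℤ → ℂ) (t0 : t 0 = 1)
    (ht : ∀ n, t (n + 1) = -(z * Q ^ n * t n)) (N : ℕ) :
    HasSum (fun n : ℤ => auxR Q (N - n) * auxR Q (N + n) * t n)
      ((∏ k ∈ Finset.range N, (1 - z * Q ^ k)) *
        (∏ k ∈ Finset.range N, (1 - Q * z⁻¹ * Q ^ k)) / auxP Q (2 * N)) := by
  induction N with
  | zero =>
    have := hasSum_single (f := fun n : ℤ => auxR Q (((0 : ℕ) : ℤ) - n) * auxR Q (((0 : ℕ) : ℤ) + n) * t n) 0 ?_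
    · simpa [auxR, auxP, t0] using this
    · intro n hn
      rcases lt_or_gt_of_ne hn with h | h
      · simp [auxR, show ¬ (0 ≤ n) by omega]
      · simp [auxR, show ¬ (n ≤ 0) by omega]
  | succ N ih =>
    have f1 := aux_factor Q hQ (2 * N)
    have f2 := aux_factor Q hQ (2 * N + 1)
    have hp := auxP_ne Q hQ (2 * N)
    have hP : auxP Q (2 * (N + 1)) =
        auxP Q (2 * N) * (1 - Q * Q ^ (2 * N)) * (1 - Q * Q ^ (2 * N + 1)) := by
      rw [show 2 * (N + 1) = 2 * N + 1 + 1 by ring]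
      unfold auxP
      rw [Finset.prod_range_succ, Finset.prod_range_succ]
    have s1 := (ih.mul_left (1 + Q * Q ^ (2 * N)))
    have s2 := ((Equiv.subRight (1 : ℤ)).hasSum_iff.mpr ih).mul_left (-(z * Q ^ N))
    have s3 := ((Equiv.addRight (1 : ℤ)).hasSum_iff.mpr ih).mul_left (-(Q * z⁻¹ * Q ^ N))
    have s := ((s1.add s2).add s3).mul_left (((1 - Q * Q ^ (2 * N)) * (1 - Q * Q ^ (2 * N + 1)))⁻¹)
    refine (hasSum_congr_aux s (fun n => ?_) ?_)
    · simp only [Function.comp, Equiv.subRight_apply, Equiv.coe_addRight]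
      have hc := aux_coeff Q hQ hQ0 (N + 1 - n) (N + 1 + n)
      have e1 : (N + 1 - n : ℤ) + (N + 1 + n) - 1 = ((2 * N + 1 : ℕ) : ℤ) := by push_cast; ring
      have e2 : (N + 1 - n : ℤ) + (N + 1 + n) = ((2 * N + 1 + 1 : ℕ) : ℤ) := by push_cast; ring
      rw [e1, e2, zpow_natCast, zpow_natCast, pow_succ' Q (2 * N + 1)] at hc
      rw [show (N : ℤ) + 1 - n - 1 = N - n by ring, show (N : ℤ) + 1 + n - 1 = N + n by ring,
        show (N : ℤ) + 1 + n - 2 = N + (n - 1) by ring,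
        show (N : ℤ) + 1 - n - 2 = N - (n + 1) by ring] at hc
      have t1 : -(z * Q ^ N) * t (n - 1) = Q ^ ((N : ℤ) + 1 - n) * t n := by
        have := ht (n - 1)
        rw [sub_add_cancel] at this
        rw [this, show (N : ℤ) + 1 - n = N - (n - 1) by ring, zpow_sub₀ hQ0, zpow_natCast]
        have := zpow_ne_zero (n - 1) hQ0
        field_simp
      have t2 : -(Q * z⁻¹ * Q ^ N) * t (n + 1) = Q ^ ((N : ℤ) + 1 + n) * t n := by
        rw [ht, zpow_add₀ hQ0, zpow_add₀ hQ0, zpow_natCast, zpow_one]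
        field_simp
      have f : ((1 - Q * Q ^ (2 * N)) * (1 - Q * Q ^ (2 * N + 1))) ≠ 0 := mul_ne_zero f1 f2
      rw [eq_inv_mul_iff_mul_eq₀ f]
      push_cast
      rw [show (N : ℤ) - (n - 1) = N + 1 - n by ring, show (N : ℤ) + (n + 1) = N + 1 + n by ring]
      rw [pow_succ' Q (2 * N)] at hc ⊢
      linear_combination t n * hc - auxR Q (N + 1 - n) * auxR Q (N + (n - 1)) * t1
        - auxR Q (N - (n + 1)) * auxR Q (N + 1 + n) * t2
    · rw [hP, Finset.prod_range_succ, Finset.prod_range_succ]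
      field_simp
      ring

lemma aux_triple (Q z : ℂ) (hQ : ‖Q‖ < 1) (hQ0 : Q ≠ 0) (hz : z ≠ 0) (t : ℤ → ℂ) (t0 : t 0 = 1)
    (ht : ∀ n, t (n + 1) = -(z * Q ^ n * t n)) (hs : Summable t) :
    ∑' n, t n = thetaC Q z := by
  obtain ⟨C, hC0, hC⟩ := auxR_bound Q hQ
  have hne := aux_ne Q hQ
  have l1 : Filter.Tendsto (fun N : ℕ => ∑' n : ℤ, auxR Q (N - n) * auxR Q (N + n) * t n)
      Filter.atTop (nhds (∑' n : ℤ, (qPochC Q Q)⁻¹ * (qPochC Q Q)⁻¹ * t n)) := by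
    refine tendsto_tsum_of_dominated_convergence (bound := fun n => C * C * ‖t n‖)
      (hs.norm.mul_left _) (fun n => ?_) (Filter.Eventually.of_forall fun N n => ?_)
    · refine Filter.Tendsto.mul_const _ (Filter.Tendsto.mul ?_ ?_)
      · refine (auxR_tendsto Q hQ).comp ?_
        exact Filter.tendsto_atTop_add_const_right _ (-n) tendsto_natCast_atTop_atTop
      · refine (auxR_tendsto Q hQ).comp ?_
        exact Filter.tendsto_atTop_add_const_right _ n tendsto_natCast_atTop_atTop
    · rw [norm_mul, norm_mul]
      gcongr
      · exact hC _
      · exact hC _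
  have l2 := ((aux_tendsto Q z hQ).mul (aux_tendsto Q (Q * z⁻¹) hQ)).div
    ((auxP_tendsto Q hQ).comp (Filter.tendsto_id.const_mul_atTop' (show 0 < 2 by norm_num))) hne
  have := tendsto_nhds_unique l1 (l2.congr fun N =>
    ((aux_finite Q z hQ hQ0 hz t t0 ht N).tsum_eq).symm)
  rw [tsum_mul_left] at this
  unfold thetaC
  rw [eq_div_iff hne] at this
  have e : ∑' n, t n = (qPochC Q Q) * (((qPochC Q Q)⁻¹ * (qPochC Q Q)⁻¹ * ∑' n, t n) * qPochC Q Q) := by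
    field_simp
  rw [e, this]
  ring

/-- Theta transformation formula:
`ϑ[1/2;-1/2](v/r; π√-1/(εr)) = √(εr/π) exp(-εr/4) [v]` where `x = e^{-ε}`. -/
theorem theta_transformation (ε r : ℝ) (hε : 0 < ε) (hr : 0 < r) (v : ℂ) :
    jTheta (1 / 2) (-(1 / 2)) (v / (r : ℂ)) ((Real.pi : ℂ) * Complex.I / ((ε : ℂ) * (r : ℂ))) =
      (Real.sqrt (ε * r / Real.pi) : ℂ) * Complex.exp (-((ε : ℂ) * (r : ℂ)) / 4) *
        ebrk (Real.exp (-ε)) r v := by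
  have hε' : (ε : ℂ) ≠ 0 := by exact_mod_cast hε.ne'
  have hr' : (r : ℂ) ≠ 0 := by exact_mod_cast hr.ne'
  have hpi : (Real.pi : ℂ) ≠ 0 := by exact_mod_cast Real.pi_ne_zero
  have hI := Complex.I_ne_zero
  have hx : ∀ s : ℂ, ((Real.exp (-ε) : ℝ) : ℂ) ^ s = Complex.exp (-ε * s) := by
    intro s
    rw [Complex.cpow_def_of_ne_zero (by exact_mod_cast (Real.exp_pos _).ne'),
      ← Complex.ofReal_log (Real.exp_pos _).le, Real.log_exp]
    push_cast; rfl
  set τ : ℂ := (Real.pi : ℂ) * Complex.I / ((ε : ℂ) * (r : ℂ)) with hτ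
  set w : ℂ := v / r - 1 / 2 with hw
  -- step 1: rewrite through `jacobiTheta₂`
  have h1 : jTheta (1 / 2) (-(1 / 2)) (v / (r : ℂ)) τ =
      Complex.exp (Real.pi * Complex.I * (τ / 4 + w)) * jacobiTheta₂ (w + τ / 2) τ := by
    unfold jTheta jacobiTheta₂
    rw [← tsum_mul_left]
    congr 1
    funext m
    rw [jacobiTheta₂_term, ← Complex.exp_add, hw]
    congr 1
    push_cast
    ring
  have hsq : 1 / (-Complex.I * τ) ^ (1 / 2 : ℂ) = (Real.sqrt (ε * r / Real.pi) : ℂ) := by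
    have e : -Complex.I * τ = ((Real.pi / (ε * r) : ℝ) : ℂ) := by
      rw [hτ]; push_cast; field_simp; rw [Complex.I_sq]; ring
    have hp : 0 < Real.pi / (ε * r) := by positivity
    rw [e, show (1 / 2 : ℂ) = ((1 / 2 : ℝ) : ℂ) by push_cast; rfl,
      ← Complex.ofReal_cpow hp.le, ← Real.sqrt_eq_rpow, one_div, ← Complex.ofReal_inv, ← Real.sqrt_inv, inv_div]
  have hti : -1 / τ = ((ε * r / Real.pi : ℝ) : ℂ) * Complex.I := by
    rw [hτ]; push_cast; field_simp; rw [Complex.I_sq]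
  have hzt : (w + τ / 2) / τ = -(-(w * (-(ε * r / Real.pi) * Complex.I)) - 1 / 2) := by
    rw [hτ]; field_simp; linear_combination (2 * w * ε * r) * Complex.I_sq
  have him : 0 < (-1 / τ).im := by
    rw [hti]
    simp only [Complex.mul_im, Complex.ofReal_re, Complex.I_im, Complex.ofReal_im, Complex.I_re]
    have : 0 < ε * r / Real.pi := by positivity
    linarith
  have h3 : jacobiTheta₂ ((w + τ / 2) / τ) (-1 / τ) =
      thetaC (Complex.exp (-ε * ((2 * r : ℝ) : ℂ))) (Complex.exp (-ε * (2 * v))) := by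
    rw [hzt, jacobiTheta₂_neg_left]
    refine aux_triple _ _ ?_ (Complex.exp_ne_zero _) (Complex.exp_ne_zero _) _ ?_ ?_
      ((summable_jacobiTheta₂_term_iff _ _).mpr him)
    · rw [Complex.norm_exp]
      have : (-(ε : ℂ) * ((2 * r : ℝ) : ℂ)).re = -(ε * (2 * r)) := by
        rw [← Complex.ofReal_neg, ← Complex.ofReal_mul, Complex.ofReal_re]; ring
      rw [this, Real.exp_lt_one_iff]
      have : 0 < ε * (2 * r) := by positivity
      linarith
    · simp [jacobiTheta₂_term]
    · intro n
      rw [jacobiTheta₂_term, jacobiTheta₂_term, ← Complex.exp_int_mul, ← Complex.exp_add,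
        ← Complex.exp_add, hti]
      have hneg : ∀ c : ℂ, -Complex.exp c = Complex.exp (-(Real.pi * Complex.I) + c) := by
        intro c
        rw [Complex.exp_add, Complex.exp_neg, Complex.exp_pi_mul_I]
        norm_num
      rw [hneg]
      congr 1
      rw [hw]
      push_cast
      field_simp
      ring_nf
      simp only [Complex.I_sq]
      ring
  rw [h1, jacobiTheta₂_functional_equation, hsq, h3, ebrk, hx, hx, hx]
  have h4 : Complex.exp (Real.pi * Complex.I * (τ / 4 + w)) *
      Complex.exp (-Real.pi * Complex.I * (w + τ / 2) ^ 2 / τ) =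
      Complex.exp (-((ε : ℂ) * (r : ℂ)) / 4) * Complex.exp (-ε * (v ^ 2 / (r : ℂ) - v)) := by
    rw [← Complex.exp_add, ← Complex.exp_add]
    congr 1
    rw [hτ, hw]
    field_simp
    ring
  linear_combination (Real.sqrt (ε * r / Real.pi) : ℂ) *
    thetaC (Complex.exp (-ε * ((2 * r : ℝ) : ℂ))) (Complex.exp (-ε * (2 * v))) * h4

end
end

section
/- Yang–Baxter equation for Belavin's R-matrix: for all spectral parameters v₁, v₂, v₃ ∈ ℂ at which all factors are defined, R̄₁₂(v₁−v₂) R̄₁₃(v₁−v₃) R̄₂₃(v₂−v₃) = R̄₂₃(v₂−v₃) R̄₁₃(v₁−v₃) R̄₁₂(v₁−v₂) as operators on (ℂ^n)^{⊗3}, where R̄_{ij}(v) acts as R̄(v) on the i-th and j-th tensor factors and as the identity on the remaining factor. -/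
noncomputable section

open scoped Kronecker

/-- `ω = exp(2π√-1/n)`. -/
def omC (n : ℕ) : ℂ := Complex.exp (2 * (Real.pi : ℂ) * Complex.I / (n : ℂ))

/-- The diagonal matrix `g v_i = ω^i v_i`. -/
def gmat (n : ℕ) : Matrix (ZMod n) (ZMod n) ℂ :=
  Matrix.diagonal fun i => omC n ^ i.val

/-- The shift matrix `h v_i = v_{i-1}`. -/
def hmat (n : ℕ) : Matrix (ZMod n) (ZMod n) ℂ :=
  Matrix.of fun i j => if i = j - 1 then 1 else 0

/-- `I_α = g^{α₁} h^{α₂}`. -/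
def Imat (n : ℕ) [NeZero n] (α : ZMod n × ZMod n) : Matrix (ZMod n) (ZMod n) ℂ :=
  gmat n ^ α.1.val * hmat n ^ α.2.val

/-- Belavin's `R̄`-matrix:
`R̄(v) = (1/n) Σ_α (ϑ_α(1/(nr) - v/r; π√-1/(εr)) / ϑ_α(1/(nr); π√-1/(εr))) I_α ⊗ I_α⁻¹`,
with matrix element `R̄(v)^{ik}_{jl}` given by the entry at row `(i,k)`, column `(j,l)`. -/
def Rbar (n : ℕ) [NeZero n] (ε r : ℝ) (v : ℂ) :
    Matrix (ZMod n × ZMod n) (ZMod n × ZMod n) ℂ :=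
  ((n : ℂ))⁻¹ • ∑ α : ZMod n × ZMod n,
    (jTheta (1 / 2 - (α.1.val : ℝ) / n) (1 / 2 + (α.2.val : ℝ) / n)
        (1 / ((n : ℂ) * (r : ℂ)) - v / (r : ℂ)) ((Real.pi : ℂ) * Complex.I / ((ε : ℂ) * (r : ℂ))) /
      jTheta (1 / 2 - (α.1.val : ℝ) / n) (1 / 2 + (α.2.val : ℝ) / n)
        (1 / ((n : ℂ) * (r : ℂ))) ((Real.pi : ℂ) * Complex.I / ((ε : ℂ) * (r : ℂ)))) •
    (Imat n α ⊗ₖ (Imat n α)⁻¹)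


/-- `R̄₁₂(v)`: `R̄(v)` acting on the first and second factors of `(ℂⁿ)^⊗3`. -/
def R12 (n : ℕ) [NeZero n] (ε r : ℝ) (v : ℂ) :
    Matrix (ZMod n × ZMod n × ZMod n) (ZMod n × ZMod n × ZMod n) ℂ :=
  Matrix.of fun p q =>
    Rbar n ε r v (p.1, p.2.1) (q.1, q.2.1) * (if p.2.2 = q.2.2 then 1 else 0)

/-- `R̄₁₃(v)`: `R̄(v)` acting on the first and third factors of `(ℂⁿ)^⊗3`. -/
def R13 (n : ℕ) [NeZero n] (ε r : ℝ) (v : ℂ) :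
    Matrix (ZMod n × ZMod n × ZMod n) (ZMod n × ZMod n × ZMod n) ℂ :=
  Matrix.of fun p q =>
    Rbar n ε r v (p.1, p.2.2) (q.1, q.2.2) * (if p.2.1 = q.2.1 then 1 else 0)

/-- `R̄₂₃(v)`: `R̄(v)` acting on the second and third factors of `(ℂⁿ)^⊗3`. -/
def R23 (n : ℕ) [NeZero n] (ε r : ℝ) (v : ℂ) :
    Matrix (ZMod n × ZMod n × ZMod n) (ZMod n × ZMod n × ZMod n) ℂ :=
  Matrix.of fun p q =>
    Rbar n ε r v (p.2.1, p.2.2) (q.2.1, q.2.2) * (if p.1 = q.1 then 1 else 0)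


open Complex in
lemma exp_neg_of (a b : ℂ) (h : a = b + Real.pi * I) : cexp a = - cexp b := by
  rw [h, Complex.exp_add, Complex.exp_pi_mul_I]; ring

open Complex in
lemma jt_prod (x y τ : ℂ) (hτ : 0 < τ.im) :
    jacobiTheta₂ (x + y) τ * jacobiTheta₂ (x - y) τ =
      jacobiTheta₂ (2 * x) (2 * τ) * jacobiTheta₂ (2 * y) (2 * τ) +
      cexp (2 * Real.pi * I * (x + y) + Real.pi * I * τ) *
        (jacobiTheta₂ (2 * x + τ) (2 * τ) * jacobiTheta₂ (2 * y + τ) (2 * τ)) := by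
  have h2 : 0 < (2 * τ).im := by simpa using hτ
  have S (z : ℂ) {t : ℂ} (ht : 0 < t.im) : Summable (fun n => ‖jacobiTheta₂_term n z t‖) :=
    ((summable_jacobiTheta₂_term_iff z t).mpr ht).norm
  unfold jacobiTheta₂
  rw [tsum_mul_tsum_of_summable_norm (S _ hτ) (S _ hτ),
    tsum_mul_tsum_of_summable_norm (S _ h2) (S _ h2),
    tsum_mul_tsum_of_summable_norm (S _ h2) (S _ h2), ← tsum_mul_left]
  have hs := summable_mul_of_summable_norm (S (x + y) hτ) (S (x - y) hτ)
  let F : (ℤ × ℤ) ⊕ (ℤ × ℤ) → ℤ × ℤ :=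
    Sum.elim (fun p => (p.1 + p.2, p.1 - p.2)) (fun p => (p.1 + p.2 + 1, p.1 - p.2))
  have hF : Function.Bijective F := by
    constructor
    · rintro (⟨a, b⟩ | ⟨a, b⟩) (⟨c, d⟩ | ⟨c, d⟩) h <;> simp [F] at h ⊢ <;> omega
    · rintro ⟨m, k⟩
      rcases Int.even_or_odd' (m - k) with ⟨c, hc | hc⟩
      · exact ⟨Sum.inl (k + c, c), by simp [F]; omega⟩
      · exact ⟨Sum.inr (k + c, c), by simp [F]; omega⟩
  let e := Equiv.ofBijective F hF
  rw [← e.tsum_eq]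
  have hs' := e.summable_iff.mpr hs
  have hinl := hs'.comp_injective (i := Sum.inl) Sum.inl_injective
  have hinr := hs'.comp_injective (i := Sum.inr) Sum.inr_injective
  rw [show (∑' c, jacobiTheta₂_term (e c).1 (x + y) τ * jacobiTheta₂_term (e c).2 (x - y) τ) = _ from
    (hinl.hasSum.sum hinr.hasSum).tsum_eq]
  congr 1
  · refine tsum_congr fun p => ?_
    simp only [Function.comp, e, F, Equiv.ofBijective_apply, Sum.elim_inl, jacobiTheta₂_term, ← Complex.exp_add]
    congr 1
    push_cast
    ring
  · refine tsum_congr fun p => ?_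
    simp only [Function.comp, e, F, Equiv.ofBijective_apply, Sum.elim_inr, jacobiTheta₂_term, ← Complex.exp_add]
    congr 1
    push_cast
    ring

/-- the odd theta function -/
def bTh (τ z : ℂ) : ℂ :=
  Complex.exp (Real.pi * Complex.I * (τ / 4 + z + 1 / 2)) * jacobiTheta₂ (z + 1 / 2 + τ / 2) τ

open Complex in
lemma jTheta_eq (p q : ℝ) (z τ : ℂ) :
    (∑' m : ℤ, Complex.exp ((Real.pi : ℂ) * Complex.I * ((m : ℂ) + ((1 / 2 - p : ℝ) : ℂ)) *
    (((m : ℂ) + ((1 / 2 - p : ℝ) : ℂ)) * τ + 2 * (z + ((1 / 2 + q : ℝ) : ℂ))))) =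
      cexp (Real.pi * I * (p ^ 2 * τ - 2 * p * (z + 1 / 2 + q))) * bTh τ (z + (q - p * τ)) := by
  unfold bTh jacobiTheta₂
  rw [← mul_assoc, ← Complex.exp_add, ← tsum_mul_left]
  refine tsum_congr fun m => ?_
  rw [jacobiTheta₂_term, ← Complex.exp_add]
  congr 1
  push_cast
  ring

open Complex in
lemma bTh_add_one (τ z : ℂ) : bTh τ (z + 1) = - bTh τ z := by
  unfold bTh
  rw [show z + 1 + 1 / 2 + τ / 2 = (z + 1 / 2 + τ / 2) + 1 by ring, jacobiTheta₂_add_left,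
    show Real.pi * I * (τ / 4 + (z + 1) + 1 / 2) = Real.pi * I * (τ / 4 + z + 1 / 2) + Real.pi * I by ring,
    Complex.exp_add, Complex.exp_pi_mul_I]
  ring

open Complex in
lemma bTh_add_tau (τ z : ℂ) :
    bTh τ (z + τ) = - cexp (- Real.pi * I * τ - 2 * Real.pi * I * z) * bTh τ z := by
  unfold bTh
  rw [show z + τ + 1 / 2 + τ / 2 = (z + 1 / 2 + τ / 2) + τ by ring, jacobiTheta₂_add_left',
    ← mul_assoc, ← mul_assoc, ← Complex.exp_add, neg_mul (cexp _) (cexp _), ← Complex.exp_add]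
  congr 1
  rw [eq_comm, neg_eq_iff_eq_neg]
  apply exp_neg_of
  ring

open Complex in
lemma bTh_neg (τ z : ℂ) : bTh τ (-z) = - bTh τ z := by
  unfold bTh
  have h := jacobiTheta₂_add_left' (-z - 1 / 2 - τ / 2) τ
  have h' := jacobiTheta₂_add_left (-z - 1 / 2 + τ / 2) τ
  rw [show -z + 1 / 2 + τ / 2 = (-z - 1 / 2 + τ / 2) + 1 by ring, h',
    show (-z - 1 / 2 + τ / 2) = -z - 1 / 2 - τ / 2 + τ by ring, h,
    show -z - 1 / 2 - τ / 2 = -(z + 1 / 2 + τ / 2) by ring, jacobiTheta₂_neg_left,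
    ← mul_assoc, ← Complex.exp_add, ← neg_mul (cexp _)]
  congr 1
  apply exp_neg_of
  ring

open Complex in
lemma bTh_bilin (τ : ℂ) (hτ : 0 < τ.im) : ∃ A B : ℂ → ℂ, ∀ x y,
    bTh τ (x + y) * bTh τ (x - y) = B x * A y - A x * B y := by
  refine ⟨fun x => jacobiTheta₂ (2 * x) (2 * τ),
    fun x => cexp (Real.pi * I * (τ / 2 + 1 + 2 * x)) * jacobiTheta₂ (2 * x + τ) (2 * τ), fun x y => ?_⟩
  have h := jt_prod (x + 1 / 2 + τ / 2) y τ hτ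
  unfold bTh
  rw [show x + y + 1 / 2 + τ / 2 = x + 1 / 2 + τ / 2 + y by ring,
    show x - y + 1 / 2 + τ / 2 = x + 1 / 2 + τ / 2 - y by ring, mul_mul_mul_comm, h,
    show 2 * (x + 1 / 2 + τ / 2) = 2 * x + τ + 1 by ring, jacobiTheta₂_add_left,
    show 2 * x + τ + 1 + τ = 2 * x + 2 * τ + 1 by ring, jacobiTheta₂_add_left,
    jacobiTheta₂_add_left', ← Complex.exp_add, mul_add]
  have e1 : cexp (Real.pi * I * (τ / 4 + (x + y) + 1 / 2) + Real.pi * I * (τ / 4 + (x - y) + 1 / 2))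
    = cexp (Real.pi * I * (τ / 2 + 1 + 2 * x)) := by
    congr 1; ring
  have e2 : cexp (Real.pi * I * (τ / 2 + 1 + 2 * x)) *
    (cexp (2 * Real.pi * I * (x + 1 / 2 + τ / 2 + y) + Real.pi * I * τ) *
      cexp (-Real.pi * I * (2 * τ + 2 * (2 * x)))) = - cexp (Real.pi * I * (τ / 2 + 1 + 2 * y)) := by
    simp only [← Complex.exp_add]
    apply exp_neg_of
    ring
  rw [e1]
  linear_combination (jacobiTheta₂ (2 * x) (2 * τ) * jacobiTheta₂ (2 * y + τ) (2 * τ)) * e2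

lemma bTh_weier (τ : ℂ) (hτ : 0 < τ.im) (x y z w : ℂ) :
    bTh τ (x + z + w) * bTh τ (y + w) * bTh τ (x + y) * bTh τ z =
      bTh τ (x + y + w) * bTh τ (x + z) * bTh τ y * bTh τ (z + w) +
      bTh τ (z - y) * bTh τ (x + y + z + w) * bTh τ x * bTh τ w := by
  obtain ⟨A, B, h⟩ := bTh_bilin τ hτ
  have h1 := h ((x + y + z) / 2 + w) ((x + z - y) / 2)
  have h2 := h ((x + y + z) / 2) ((x + y - z) / 2)
  have h3 := h ((x + y + z) / 2 + w) ((x + y - z) / 2)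
  have h4 := h ((x + y + z) / 2) ((x + z - y) / 2)
  have h5 := h ((x + y + z) / 2 + w) ((x + y + z) / 2)
  have h6 := h ((x + z - y) / 2) ((x + y - z) / 2)
  rw [show (x + y + z) / 2 + w + (x + z - y) / 2 = x + z + w by ring,
    show (x + y + z) / 2 + w - (x + z - y) / 2 = y + w by ring] at h1
  rw [show (x + y + z) / 2 + (x + y - z) / 2 = x + y by ring,
    show (x + y + z) / 2 - (x + y - z) / 2 = z by ring] at h2
  rw [show (x + y + z) / 2 + w + (x + y - z) / 2 = x + y + w by ring,
    show (x + y + z) / 2 + w - (x + y - z) / 2 = z + w by ring] at h3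
  rw [show (x + y + z) / 2 + (x + z - y) / 2 = x + z by ring,
    show (x + y + z) / 2 - (x + z - y) / 2 = y by ring] at h4
  rw [show (x + y + z) / 2 + w + (x + y + z) / 2 = x + y + z + w by ring,
    show (x + y + z) / 2 + w - (x + y + z) / 2 = w by ring] at h5
  rw [show (x + z - y) / 2 + (x + y - z) / 2 = x by ring,
    show (x + z - y) / 2 - (x + y - z) / 2 = z - y by ring] at h6
  calc _ = (bTh τ (x + z + w) * bTh τ (y + w)) * (bTh τ (x + y) * bTh τ z) := by ring
    _ = (bTh τ (x + y + w) * bTh τ (z + w)) * (bTh τ (x + z) * bTh τ y) +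
        (bTh τ (x + y + z + w) * bTh τ w) * (bTh τ x * bTh τ (z - y)) := by
      rw [h1, h2, h3, h4, h5, h6]; ring
    _ = _ := by ring

lemma bTh_diff (τ : ℂ) (hτ : 0 < τ.im) : Differentiable ℂ (bTh τ) := by
  intro z
  unfold bTh
  have := (differentiableAt_jacobiTheta₂_fst (z + 1 / 2 + τ / 2) hτ)
  have h2 : DifferentiableAt ℂ (fun z : ℂ => jacobiTheta₂ (z + 1 / 2 + τ / 2) τ) z := by
    exact DifferentiableAt.comp (g := fun z => jacobiTheta₂ z τ) z this (by fun_prop)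
  fun_prop

lemma bTh_zero (τ : ℂ) : bTh τ 0 = 0 := by
  have := bTh_neg τ 0
  rw [neg_zero] at this
  exact self_eq_neg.mp this

lemma bTh_hd (τ : ℂ) (hτ : 0 < τ.im) (z : ℂ) : HasDerivAt (bTh τ) (deriv (bTh τ) z) z :=
  (bTh_diff τ hτ z).hasDerivAt

lemma bTh_hd_add (τ : ℂ) (hτ : 0 < τ.im) (c z : ℂ) :
    HasDerivAt (fun z => bTh τ (z + c)) (deriv (bTh τ) (z + c)) z :=
  (bTh_hd τ hτ (z + c)).comp_add_const z c

lemma bTh_deriv_neg (τ : ℂ) (z : ℂ) : deriv (bTh τ) (-z) = deriv (bTh τ) z := by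
  have h : (fun z => bTh τ (-z)) = fun z => - bTh τ z := funext (bTh_neg τ)
  have h1 := deriv_comp_neg (bTh τ) z
  rw [h] at h1
  simp only [deriv.fun_neg] at h1
  exact (neg_injective h1).symm

lemma bTh_deriv_id (τ : ℂ) (hτ : 0 < τ.im) (x y w : ℂ) :
    bTh τ (x + w) * bTh τ (y + w) * bTh τ (x + y) * deriv (bTh τ) 0 =
      bTh τ (x + y + w) * (deriv (bTh τ) x * bTh τ w + bTh τ x * deriv (bTh τ) w) * bTh τ y +
      (deriv (bTh τ) y * bTh τ (x + y + w) - bTh τ y * deriv (bTh τ) (x + y + w)) *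
        bTh τ x * bTh τ w := by
  have hL : HasDerivAt (fun z => bTh τ (z + (x + w)) * (bTh τ (y + w) * bTh τ (x + y)) * bTh τ z)
      _ 0 := ((bTh_hd_add τ hτ (x + w) 0).mul_const _).mul (bTh_hd τ hτ 0)
  have hR : HasDerivAt (fun z => (bTh τ (z + x) * (bTh τ (x + y + w) * bTh τ y)) * bTh τ (z + w) +
      (bTh τ (z + -y) * (bTh τ x * bTh τ w)) * bTh τ (z + (x + y + w))) _ 0 :=
    (((bTh_hd_add τ hτ x 0).mul_const _).mul (bTh_hd_add τ hτ w 0)).add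
      (((bTh_hd_add τ hτ (-y) 0).mul_const _).mul (bTh_hd_add τ hτ (x + y + w) 0))
  have he : (fun z => bTh τ (z + (x + w)) * (bTh τ (y + w) * bTh τ (x + y)) * bTh τ z) =
     (fun z => (bTh τ (z + x) * (bTh τ (x + y + w) * bTh τ y)) * bTh τ (z + w) +
      (bTh τ (z + -y) * (bTh τ x * bTh τ w)) * bTh τ (z + (x + y + w))) := by
    funext z
    have := bTh_weier τ hτ x y z w
    rw [show z + (x + w) = x + z + w by ring, show z + x = x + z by ring,
      show z + (x + y + w) = x + y + z + w by ring, ← sub_eq_add_neg]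
    linear_combination this
  rw [he] at hL
  have := hL.unique hR
  simp only [zero_add, bTh_zero, bTh_neg, bTh_deriv_neg] at this
  linear_combination this

open Complex in
lemma bTh_deriv_add_one (τ : ℂ) (z : ℂ) :
    deriv (bTh τ) (z + 1) = - deriv (bTh τ) z := by
  have h : (fun z => bTh τ (z + 1)) = fun z => - bTh τ z := funext (bTh_add_one τ)
  have h1 := deriv_comp_add_const (bTh τ) 1 z
  rw [h] at h1
  simp only [deriv.fun_neg] at h1
  exact h1.symm

open Complex in
lemma bTh_deriv_add_tau (τ : ℂ) (hτ : 0 < τ.im) (z : ℂ) :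
    deriv (bTh τ) (z + τ) = - cexp (- Real.pi * I * τ - 2 * Real.pi * I * z) *
      (deriv (bTh τ) z - 2 * Real.pi * I * bTh τ z) := by
  have h : (fun z => bTh τ (z + τ)) = fun z => - cexp (- Real.pi * I * τ - 2 * Real.pi * I * z) * bTh τ z :=
    funext (bTh_add_tau τ)
  have h1 := bTh_hd_add τ hτ τ z
  rw [h] at h1
  have h3 : HasDerivAt (fun z : ℂ => - Real.pi * I * τ - 2 * Real.pi * I * z) (- (2 * Real.pi * I)) z := by
    simpa using ((hasDerivAt_id z).const_mul (2 * Real.pi * I)).const_sub (- Real.pi * I * τ)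
  have h2 := (h3.cexp.fun_neg).mul (bTh_hd τ hτ z)
  rw [h1.unique h2]
  ring

/-- logarithmic derivative -/
def bL (τ z : ℂ) : ℂ := deriv (bTh τ) z / bTh τ z

lemma bTh_eq_zero_add_one (τ z : ℂ) : bTh τ (z + 1) = 0 ↔ bTh τ z = 0 := by
  rw [bTh_add_one, neg_eq_zero]

lemma bTh_eq_zero_add_tau (τ z : ℂ) : bTh τ (z + τ) = 0 ↔ bTh τ z = 0 := by
  rw [bTh_add_tau]; simp [Complex.exp_ne_zero]

lemma bL_add_one (τ z : ℂ) : bL τ (z + 1) = bL τ z := by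
  rw [bL, bTh_add_one, bTh_deriv_add_one, neg_div_neg_eq, bL]

lemma bL_neg (τ z : ℂ) : bL τ (-z) = - bL τ z := by
  rw [bL, bTh_neg, bTh_deriv_neg, div_neg, bL]

lemma bL_add_tau (τ : ℂ) (hτ : 0 < τ.im) (z : ℂ) (hz : bTh τ z ≠ 0) :
    bL τ (z + τ) = bL τ z - 2 * Real.pi * Complex.I := by
  rw [bL, bTh_add_tau, bTh_deriv_add_tau τ hτ, mul_div_mul_left _ _ (by simp [Complex.exp_ne_zero]),
    sub_div, mul_div_cancel_right₀ _ hz, bL]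

lemma bTh_ne_ev (τ : ℂ) (hτ : 0 < τ.im) (h0 : ∃ z, bTh τ z ≠ 0) (c : ℂ) :
    ∀ᶠ z in nhdsWithin c {c}ᶜ, bTh τ z ≠ 0 := by
  have ha : AnalyticOnNhd ℂ (bTh τ) Set.univ :=
    (bTh_diff τ hτ).differentiableOn.analyticOnNhd isOpen_univ
  rcases (ha c trivial).eventually_eq_zero_or_eventually_ne_zero with h | h
  · obtain ⟨z, hz⟩ := h0
    exact absurd (ha.eqOn_zero_of_preconnected_of_eventuallyEq_zero isPreconnected_univ trivial h
      (Set.mem_univ z)) hz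
  · exact h

open Complex in
lemma bTh_nonvan (τ : ℂ) (hτ : 0 < τ.im) (h0 : ∃ z, bTh τ z ≠ 0) (S : ℂ)
    (hS : ∀ m k : ℤ, S ≠ m + k * τ) : bTh τ S * deriv (bTh τ) 0 ≠ 0 := by
  intro hzero
  -- choose w
  obtain ⟨w, hw1, hw2⟩ : ∃ w, bTh τ w ≠ 0 ∧ bTh τ (S + w) ≠ 0 := by
    have e1 := bTh_ne_ev τ hτ h0 0
    have e2 := bTh_ne_ev τ hτ h0 S
    have ht : Filter.Tendsto (fun w => S + w) (nhdsWithin 0 {0}ᶜ) (nhdsWithin S {S}ᶜ) := by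
      apply tendsto_nhdsWithin_iff.mpr
      constructor
      · have : Filter.Tendsto (fun w => S + w) (nhds 0) (nhds (S + 0)) :=
          (continuous_const.add continuous_id).tendsto 0
        rw [add_zero] at this
        exact this.mono_left nhdsWithin_le_nhds
      · filter_upwards [self_mem_nhdsWithin] with w hw
        simpa using hw
    exact (e1.and (ht.eventually e2)).exists
  set K : ℂ := - (bTh τ (S + w) * deriv (bTh τ) w - deriv (bTh τ) (S + w) * bTh τ w) /
    (bTh τ (S + w) * bTh τ w) with hK
  have key : ∀ x, deriv (bTh τ) x * bTh τ (S - x) + bTh τ x * deriv (bTh τ) (S - x) =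
      K * (bTh τ x * bTh τ (S - x)) := by
    intro x
    have h := bTh_deriv_id τ hτ x (S - x) w
    rw [add_sub_cancel] at h
    have : (bTh τ (S + w) * bTh τ w) ≠ 0 := mul_ne_zero hw2 hw1
    rw [hK, div_mul_eq_mul_div, eq_div_iff this]
    linear_combination (bTh τ (x + w) * bTh τ (S - x + w)) * hzero - h
  let G : ℂ → ℂ := fun x => bTh τ (S - x)
  let H : ℂ → ℂ := fun x => bTh τ x * cexp (- K * x)
  have hG : ∀ x, HasDerivAt G (- deriv (bTh τ) (S - x)) x := fun x => by
    simpa using (bTh_hd τ hτ (S - x)).comp_const_sub S x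
  have hH : ∀ x, HasDerivAt H (deriv (bTh τ) x * cexp (- K * x) + bTh τ x * (cexp (-K * x) * (-K))) x := by
    intro x
    have : HasDerivAt (fun x : ℂ => - K * x) (-K) x := by simpa using (hasDerivAt_id x).const_mul (-K)
    exact (bTh_hd τ hτ x).mul this.cexp
  obtain ⟨z0, hz0⟩ := h0
  have hGx : G (S - z0) ≠ 0 := by simpa [G] using hz0
  have hGc : Continuous G := continuous_iff_continuousAt.mpr fun x => (hG x).continuousAt
  obtain ⟨δ, hδ, hball⟩ := Metric.eventually_nhds_iff_ball.mp (hGc.continuousAt.eventually_ne hGx)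
  obtain ⟨c, hc⟩ : ∃ c, ∀ x ∈ Metric.ball (S - z0) δ, H x = c * G x := by
    refine ⟨H (S - z0) / G (S - z0), fun x hx => ?_⟩
    have hd : ∀ y ∈ Metric.ball (S - z0) δ, HasDerivAt (fun y => H y / G y) 0 y := by
      intro y hy
      refine ((hH y).div (hG y) (hball y hy)).congr_deriv ?_
      rw [div_eq_zero_iff]
      left
      have := key y
      simp only [G, H]
      linear_combination cexp (-K * y) * this
    have := (convex_ball (S - z0) δ).is_const_of_fderivWithin_eq_zero (𝕜 := ℂ)
      (f := fun y => H y / G y) (fun y hy => (hd y hy).differentiableAt.differentiableWithinAt)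
      (fun y hy => by
        rw [fderivWithin_of_isOpen Metric.isOpen_ball hy]
        have := (hd y hy).hasFDerivAt.fderiv
        rw [this]; ext; simp) hx (Metric.mem_ball_self hδ)
    rw [← this, div_mul_cancel₀ _ (hball x hx)]
  have hall : ∀ x, H x = c * G x := by
    have aH : AnalyticOnNhd ℂ H Set.univ :=
      (show Differentiable ℂ H from fun x => (hH x).differentiableAt).differentiableOn.analyticOnNhd isOpen_univ
    have aG : AnalyticOnNhd ℂ (fun x => c * G x) Set.univ :=
      (show Differentiable ℂ (fun x => c * G x) from
        fun x => ((hG x).const_mul c).differentiableAt).differentiableOn.analyticOnNhd isOpen_univ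
    have := aH.eq_of_eventuallyEq aG (z₀ := S - z0)
      (Filter.eventually_of_mem (Metric.ball_mem_nhds _ hδ) hc)
    exact fun x => congrFun this x
  -- the point z0 has H nonzero
  have hHz : H z0 ≠ 0 := mul_ne_zero hz0 (Complex.exp_ne_zero _)
  have p1 : cexp (-K) = 1 := by
    have h1 := hall (z0 + 1)
    have hg : G (z0 + 1) = - G z0 := by
      have := bTh_add_one τ (S - (z0 + 1))
      simp only [G]
      rw [show S - (z0 + 1) + 1 = S - z0 by ring] at this
      rw [this, neg_neg]
    have hh : H (z0 + 1) = - cexp (-K) * H z0 := by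
      simp only [H]
      rw [bTh_add_one, mul_add, Complex.exp_add, mul_one]; ring
    rw [hg, hh] at h1
    have h2 := hall z0
    apply mul_right_cancel₀ hHz
    linear_combination - h1 - h2
  have p2 : cexp (-K * τ - 2 * Real.pi * I * S) = 1 := by
    have h1 := hall (z0 + τ)
    have h2 := hall z0
    have hg : G z0 = - cexp (- Real.pi * I * τ - 2 * Real.pi * I * (S - z0 - τ)) * G (z0 + τ) := by
      have := bTh_add_tau τ (S - z0 - τ)
      simp only [G]
      rw [show S - z0 - τ + τ = S - z0 by ring] at this
      rw [this]
      congr 2; ring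
    have hh : H (z0 + τ) = - cexp (- Real.pi * I * τ - 2 * Real.pi * I * z0) * cexp (-K * τ) * H z0 := by
      simp only [H]
      rw [bTh_add_tau, mul_add, Complex.exp_add]; ring
    rw [hh] at h1
    have h3 : H z0 = (cexp (- Real.pi * I * τ - 2 * Real.pi * I * (S - z0 - τ)) *
      (cexp (- Real.pi * I * τ - 2 * Real.pi * I * z0) * cexp (-K * τ))) * H z0 := by
      linear_combination h2 + c * hg + cexp (- Real.pi * I * τ - 2 * Real.pi * I * (S - z0 - τ)) * h1
    have h4 := mul_right_cancel₀ hHz ((one_mul (H z0)).trans h3)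
    rw [h4]
    simp only [← Complex.exp_add]
    congr 1
    ring
  obtain ⟨k, hk⟩ := Complex.exp_eq_one_iff.mp p1
  obtain ⟨m, hm⟩ := Complex.exp_eq_one_iff.mp p2
  apply hS (-m) k
  have hpi : (2 * Real.pi * I : ℂ) ≠ 0 := Complex.two_pi_I_ne_zero
  apply mul_left_cancel₀ hpi
  push_cast
  linear_combination τ * hk - hm

/-- the shift attached to an index -/
def bS (n : ℕ) (τ : ℂ) (a : ℤ × ℤ) : ℂ := (a.2 : ℂ) / n - (a.1 : ℂ) / n * τ

lemma bS_add (n : ℕ) (τ : ℂ) (a b : ℤ × ℤ) : bS n τ (a + b) = bS n τ a + bS n τ b := by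
  simp only [bS, Prod.fst_add, Prod.snd_add, Int.cast_add]; ring

lemma bS_neg (n : ℕ) (τ : ℂ) (a : ℤ × ℤ) : bS n τ (-a) = - bS n τ a := by
  simp only [bS, Prod.fst_neg, Prod.snd_neg, Int.cast_neg]; ring

lemma bS_one (n : ℕ) [NeZero n] (τ : ℂ) : bS n τ ((n : ℤ), 0) = - τ := by
  simp [bS]

lemma bS_two (n : ℕ) [NeZero n] (τ : ℂ) : bS n τ (0, (n : ℤ)) = 1 := by
  simp [bS]

lemma per_eq (n : ℕ) (F : ℤ × ℤ → ℂ) (h1 : Function.Periodic F ((n : ℤ), 0))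
    (h2 : Function.Periodic F (0, (n : ℤ))) (a b : ℤ × ℤ)
    (e1 : (a.1 : ZMod n) = b.1) (e2 : (a.2 : ZMod n) = b.2) : F a = F b := by
  rw [ZMod.intCast_eq_intCast_iff_dvd_sub] at e1 e2
  obtain ⟨k, hk⟩ := e1
  obtain ⟨l, hl⟩ := e2
  have := (h1.zsmul k).add_period (h2.zsmul l) a
  rw [← this]
  congr 1
  ext
  · simp; linarith
  · simp; linarith

/-- coefficient of the R-matrix with integer index -/
def wZ (n : ℕ) (τ ħ z : ℂ) (a : ℤ × ℤ) : ℂ :=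
  Complex.exp (-(2 * Real.pi * Complex.I * (a.1 / n) * z)) *
    (bTh τ (ħ + z + bS n τ a) / bTh τ (ħ + bS n τ a))

lemma bTh_sub_tau (τ z : ℂ) : bTh τ (z + -τ) =
    - Complex.exp (- Real.pi * Complex.I * τ + 2 * Real.pi * Complex.I * z) * bTh τ z := by
  have h := bTh_add_tau τ (z + -τ)
  rw [neg_add_cancel_right] at h
  rw [h, ← mul_assoc, neg_mul_neg, ← Complex.exp_add]
  ring_nf
  simp

lemma wZ_per1 (n : ℕ) [NeZero n] (τ ħ z : ℂ) : Function.Periodic (wZ n τ ħ z) ((n : ℤ), 0) := by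
  intro a
  have hn : (n : ℂ) ≠ 0 := NeZero.ne _
  unfold wZ
  rw [bS_add, bS_one, ← add_assoc, ← add_assoc, bTh_sub_tau, bTh_sub_tau, mul_div_mul_comm,
    ← mul_assoc, neg_div_neg_eq, ← Complex.exp_sub, ← Complex.exp_add]
  congr 2
  simp only [Prod.fst_add]
  push_cast
  field_simp
  ring

lemma wZ_per2 (n : ℕ) [NeZero n] (τ ħ z : ℂ) : Function.Periodic (wZ n τ ħ z) (0, (n : ℤ)) := by
  intro a
  unfold wZ
  rw [bS_add, bS_two, ← add_assoc, ← add_assoc, bTh_add_one, bTh_add_one, neg_div_neg_eq]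
  simp

lemma fay_w (n : ℕ) (τ : ℂ) (hτ : 0 < τ.im) (ħ z w : ℂ) (a b : ℤ × ℤ)
    (h1 : ∀ a, bTh τ (ħ + bS n τ a) ≠ 0) (h2 : ∀ a, bTh τ (2 * ħ + bS n τ a) ≠ 0) :
    bTh τ z * (wZ n τ ħ (z + w) a * wZ n τ ħ w b) =
      bTh τ (z + w) * (wZ n τ (2 * ħ) w (a + b) * wZ n τ ħ z a) -
      bTh τ w * (wZ n τ (-ħ) z (-b) * wZ n τ (2 * ħ) (z + w) (a + b)) := by
  have W := bTh_weier τ hτ (ħ + bS n τ a) (ħ + bS n τ b) z w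
  have hx := h1 a
  have hy := h1 b
  have hxy := h2 (a + b)
  unfold wZ
  rw [bS_neg, show -ħ + z + -bS n τ b = z - (ħ + bS n τ b) by ring,
    show -ħ + - bS n τ b = -(ħ + bS n τ b) by ring, bTh_neg]
  rw [bS_add] at *
  rw [show 2 * ħ + w + (bS n τ a + bS n τ b) = ħ + bS n τ a + (ħ + bS n τ b) + w by ring,
    show 2 * ħ + (bS n τ a + bS n τ b) = ħ + bS n τ a + (ħ + bS n τ b) by ring,
    show 2 * ħ + (z + w) + (bS n τ a + bS n τ b) = ħ + bS n τ a + (ħ + bS n τ b) + z + w by ring,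
    show ħ + (z + w) + bS n τ a = ħ + bS n τ a + z + w by ring,
    show ħ + w + bS n τ b = ħ + bS n τ b + w by ring,
    show ħ + z + bS n τ a = ħ + bS n τ a + z by ring]
  rw [show 2 * ħ + (bS n τ a + bS n τ b) = ħ + bS n τ a + (ħ + bS n τ b) by ring] at hxy
  generalize ħ + bS n τ a = x at *
  generalize ħ + bS n τ b = y at *
  set E := Complex.exp (-(2 * Real.pi * Complex.I * ((a.1 : ℂ) / n) * (z + w))) *
    Complex.exp (-(2 * Real.pi * Complex.I * ((b.1 : ℂ) / n) * w)) with hE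
  have E2 : Complex.exp (-(2 * Real.pi * Complex.I * (((a + b).1 : ℤ) / n) * w)) *
    Complex.exp (-(2 * Real.pi * Complex.I * ((a.1 : ℂ) / n) * z)) = E := by
    rw [hE, ← Complex.exp_add, ← Complex.exp_add]
    congr 1
    simp only [Prod.fst_add]; push_cast; ring
  have E3 : Complex.exp (-(2 * Real.pi * Complex.I * (((-b).1 : ℤ) / n) * z)) *
    Complex.exp (-(2 * Real.pi * Complex.I * (((a + b).1 : ℤ) / n) * (z + w))) = E := by
    rw [hE, ← Complex.exp_add, ← Complex.exp_add]
    congr 1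
    simp only [Prod.fst_add, Prod.fst_neg]; push_cast; ring
  clear_value E
  rw [mul_mul_mul_comm (Complex.exp _), ← hE, mul_mul_mul_comm (Complex.exp _), E2,
    mul_mul_mul_comm (Complex.exp _), E3]
  field_simp
  linear_combination E * W

/-- periodic logarithmic derivative -/
def bl (n : ℕ) (τ ħ : ℂ) (a : ℤ × ℤ) : ℂ :=
  bL τ (ħ + bS n τ a) - 2 * Real.pi * Complex.I * (a.1 / n)

lemma bl_per1 (n : ℕ) [NeZero n] (τ : ℂ) (hτ : 0 < τ.im) (ħ : ℂ)
    (h1 : ∀ a, bTh τ (ħ + bS n τ a) ≠ 0) : Function.Periodic (bl n τ ħ) ((n : ℤ), 0) := by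
  intro a
  have hn : (n : ℂ) ≠ 0 := NeZero.ne _
  have h := bL_add_tau τ hτ (ħ + bS n τ (a + ((n : ℤ), 0))) (h1 _)
  unfold bl
  rw [show ħ + bS n τ (a + ((n : ℤ), 0)) + τ = ħ + bS n τ a by rw [bS_add, bS_one]; ring] at h
  rw [h, Prod.fst_add]
  push_cast
  field_simp
  ring

lemma bl_per2 (n : ℕ) [NeZero n] (τ : ℂ) (ħ : ℂ) :
    Function.Periodic (bl n τ ħ) (0, (n : ℤ)) := by
  intro a
  unfold bl
  rw [bS_add, bS_two, ← add_assoc, bL_add_one]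
  simp

/-- coefficient of the R-matrix with index in `(ℤ/nℤ)²` -/
def wM (n : ℕ) (τ ħ z : ℂ) (a : ZMod n × ZMod n) : ℂ :=
  wZ n τ ħ z ((a.1.val : ℤ), (a.2.val : ℤ))

/-- integer representative -/
def rp (n : ℕ) (a : ZMod n × ZMod n) : ℤ × ℤ := ((a.1.val : ℤ), (a.2.val : ℤ))

lemma wM_eq (n : ℕ) [NeZero n] (τ ħ z : ℂ) (a : ZMod n × ZMod n) (b : ℤ × ℤ)
    (e1 : (b.1 : ZMod n) = a.1) (e2 : (b.2 : ZMod n) = a.2) :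
    wM n τ ħ z a = wZ n τ ħ z b :=
  per_eq n _ (wZ_per1 n τ ħ z) (wZ_per2 n τ ħ z) _ _ (by simp [e1]) (by simp [e2])

lemma fay_M (n : ℕ) [NeZero n] (τ : ℂ) (hτ : 0 < τ.im) (ħ z w : ℂ) (a b : ZMod n × ZMod n)
    (h1 : ∀ a, bTh τ (ħ + bS n τ a) ≠ 0) (h2 : ∀ a, bTh τ (2 * ħ + bS n τ a) ≠ 0) :
    bTh τ z * (wM n τ ħ (z + w) a * wM n τ ħ w b) =
      bTh τ (z + w) * (wM n τ (2 * ħ) w (a + b) * wM n τ ħ z a) -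
      bTh τ w * (wM n τ (-ħ) z (-b) * wM n τ (2 * ħ) (z + w) (a + b)) := by
  have := fay_w n τ hτ ħ z w (rp n a) (rp n b) h1 h2
  rw [← wM_eq n τ _ _ (a + b) (rp n a + rp n b) (by simp [rp]) (by simp [rp]),
    ← wM_eq n τ _ _ (a + b) (rp n a + rp n b) (by simp [rp]) (by simp [rp]),
    ← wM_eq n τ _ _ (-b) (- rp n b) (by simp [rp]) (by simp [rp])] at this
  exact this

/-- the symplectic character -/
def psi (n : ℕ) [NeZero n] (a b : ZMod n × ZMod n) : ℂ :=
  ZMod.stdAddChar (a.2 * b.1 - a.1 * b.2)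

lemma psi_sum (n : ℕ) [NeZero n] (A : ZMod n × ZMod n) (hA : A ≠ 0) :
    ∑ a, psi n a A = 0 := by
  let φ : AddChar (ZMod n × ZMod n) ℂ :=
    { toFun := fun a => psi n a A
      map_zero_eq_one' := by simp [psi]
      map_add_eq_mul' := fun a b => by
        simp only [psi]
        rw [← AddChar.map_add_eq_mul]
        congr 1
        simp only [Prod.fst_add, Prod.snd_add]; ring }
  have : φ ≠ 1 := by
    intro h
    apply hA
    have e1 : psi n (0, 1) A = 1 := congrArg (fun f : AddChar (ZMod n × ZMod n) ℂ => f (0, 1)) h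
    have e2 : psi n (1, 0) A = 1 := congrArg (fun f : AddChar (ZMod n × ZMod n) ℂ => f (1, 0)) h
    simp only [psi, one_mul, zero_mul, sub_zero, zero_sub] at e1 e2
    rw [← AddChar.map_zero_eq_one (ZMod.stdAddChar (N := n))] at e1 e2
    have := ZMod.injective_stdAddChar e1
    have h2 := ZMod.injective_stdAddChar e2
    exact Prod.ext this (neg_eq_zero.mp h2)
  exact AddChar.sum_eq_zero_of_ne_one this

lemma unit_M (n : ℕ) [NeZero n] (τ : ℂ) (hτ : 0 < τ.im) (ħ z : ℂ)
    (h1 : ∀ a, bTh τ (ħ + bS n τ a) ≠ 0) (A : ZMod n × ZMod n) (hA : A ≠ 0) :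
    ∑ a, psi n a A * (wM n τ ħ z a * wM n τ (-ħ) z (A - a)) = 0 := by
  have hn : (n : ℂ) ≠ 0 := NeZero.ne _
  set S := bS n τ (rp n A) with hSdef
  have hS : ∀ m k : ℤ, S ≠ m + k * τ := by
    intro m k h
    apply hA
    have him := congrArg Complex.im h
    have e : S = ((((rp n A).2 : ℝ) / n : ℝ) : ℂ) - ((((rp n A).1 : ℝ) / n : ℝ) : ℂ) * τ := by
      rw [hSdef, bS]; push_cast; rfl
    have e' : (m : ℂ) + k * τ = ((m : ℝ) : ℂ) + ((k : ℝ) : ℂ) * τ := by push_cast; rfl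
    rw [e, e'] at h
    have him := congrArg Complex.im h
    have hre := congrArg Complex.re h
    have hnr : (n : ℝ) ≠ 0 := NeZero.ne _
    simp only [Complex.sub_im, Complex.add_im, Complex.im_ofReal_mul, Complex.ofReal_im, zero_sub,
      zero_add, Complex.sub_re, Complex.add_re, Complex.re_ofReal_mul, Complex.ofReal_re] at him hre
    have hk : - (((rp n A).1 : ℝ) / n) = k := by
      apply mul_right_cancel₀ hτ.ne'
      linarith
    have hm : ((rp n A).2 : ℝ) / n = m := by
      rw [← hk] at hre
      linarith
    have i1 : (rp n A).1 = n * (-k) := by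
      have : ((rp n A).1 : ℝ) = n * (-k) := by rw [← hk]; field_simp
      exact_mod_cast this
    have i2 : (rp n A).2 = n * m := by
      have : ((rp n A).2 : ℝ) = n * m := by rw [← hm]; field_simp
      exact_mod_cast this
    have j1 := congrArg (Int.cast : ℤ → ZMod n) i1
    have j2 := congrArg (Int.cast : ℤ → ZMod n) i2
    simp [rp] at j1 j2
    exact Prod.ext j1 j2
  have hnv := bTh_nonvan τ hτ ⟨_, h1 0⟩ S hS
  set L : ZMod n × ZMod n → ℂ := fun a => bl n τ ħ (rp n a) with hL
  have hLeq : ∀ (a : ZMod n × ZMod n) (b : ℤ × ℤ), (b.1 : ZMod n) = a.1 → (b.2 : ZMod n) = a.2 →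
      L a = bl n τ ħ b := fun a b e1 e2 =>
    per_eq n _ (bl_per1 n τ hτ ħ h1) (bl_per2 n τ ħ) _ _ (by simp [rp, e1]) (by simp [rp, e2])
  obtain ⟨C1, C2, hC⟩ : ∃ C1 C2 : ℂ, ∀ a, bTh τ S * deriv (bTh τ) 0 *
      (wM n τ ħ z a * wM n τ (-ħ) z (A - a)) = C1 + C2 * (L a - L (a - A)) := by
    set E := Complex.exp (-(2 * Real.pi * Complex.I * (((rp n A).1 : ℂ) / n) * z)) with hE
    refine ⟨E * (bTh τ (S + z) * deriv (bTh τ) z - deriv (bTh τ) (S + z) * bTh τ z) +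
      E * (bTh τ (S + z) * bTh τ z) * (2 * Real.pi * Complex.I * (((rp n A).1 : ℂ) / n)),
      E * (bTh τ (S + z) * bTh τ z), fun a => ?_⟩
    rw [hLeq (a - A) (rp n a - rp n A) (by simp [rp]) (by simp [rp]),
      wM_eq n τ (-ħ) z (A - a) (rp n A - rp n a) (by simp [rp]) (by simp [rp])]
    rw [show wM n τ ħ z a = wZ n τ ħ z (rp n a) from rfl, hL]
    have hx := h1 (rp n a)
    have hy := h1 (rp n a - rp n A)
    simp only [bl, wZ]
    rw [sub_eq_add_neg (rp n a), sub_eq_add_neg (rp n A)] at *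
    rw [bS_add, bS_add, bS_neg, bS_neg, ← hSdef] at *
    have id := bTh_deriv_id τ hτ (ħ + bS n τ (rp n a)) (S - (ħ + bS n τ (rp n a))) z
    rw [show ħ + (bS n τ (rp n a) + -S) = -(S - (ħ + bS n τ (rp n a))) by ring] at *
    rw [bTh_neg] at hy
    rw [bL_neg, show -ħ + z + (S + -bS n τ (rp n a)) = S - (ħ + bS n τ (rp n a)) + z by ring,
      show -ħ + (S + -bS n τ (rp n a)) = S - (ħ + bS n τ (rp n a)) by ring,
      show ħ + z + bS n τ (rp n a) = ħ + bS n τ (rp n a) + z by ring]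
    generalize ħ + bS n τ (rp n a) = x at *
    rw [add_sub_cancel] at id
    have hy' : bTh τ (S - x) ≠ 0 := by simpa using hy
    have E2 : Complex.exp (-(2 * Real.pi * Complex.I * (((rp n a).1 : ℂ) / n) * z)) *
      Complex.exp (-(2 * Real.pi * Complex.I * (((rp n A + - rp n a).1 : ℤ) / n) * z)) = E := by
      rw [hE, ← Complex.exp_add]
      congr 1
      simp only [Prod.fst_add, Prod.fst_neg]; push_cast; ring
    rw [mul_mul_mul_comm (Complex.exp _), E2]
    simp only [bL, Prod.fst_add, Prod.fst_neg]
    push_cast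
    generalize S - x = y at *
    field_simp
    linear_combination (n : ℂ) * E * id
  have hshift : ∑ a, psi n a A * L (a - A) = ∑ a, psi n a A * L a := by
    rw [← Equiv.sum_comp (Equiv.addRight A)]
    refine Finset.sum_congr rfl fun a _ => ?_
    simp only [Equiv.coe_addRight, add_sub_cancel_right]
    congr 1
    simp only [psi, Prod.fst_add, Prod.snd_add]
    congr 1
    ring
  apply (mul_eq_zero_iff_left hnv).mp
  rw [Finset.mul_sum]
  have : ∀ a, bTh τ S * deriv (bTh τ) 0 * (psi n a A * (wM n τ ħ z a * wM n τ (-ħ) z (A - a))) =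
     C1 * psi n a A + C2 * (psi n a A * L a) - C2 * (psi n a A * L (a - A)) := fun a => by
    linear_combination psi n a A * hC a
  simp only [this, Finset.sum_sub_distrib, Finset.sum_add_distrib, ← Finset.mul_sum, hshift,
    psi_sum n A hA]
  ring


lemma omC_pow (n : ℕ) [NeZero n] (i : ZMod n) : omC n ^ i.val = ZMod.stdAddChar i := by
  have := ZMod.stdAddChar_coe (N := n) (i.val : ℤ)
  simp only [Int.cast_natCast, ZMod.natCast_zmod_val] at this
  rw [this, omC, ← Complex.exp_nat_mul]
  congr 1
  ring

lemma hmat_pow (n : ℕ) [NeZero n] (k : ℕ) :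
    hmat n ^ k = Matrix.of fun i j => if i = j - (k : ZMod n) then (1 : ℂ) else 0 := by
  induction k with
  | zero => ext i j; simp [Matrix.one_apply]
  | succ k ih =>
    rw [pow_succ, ih]
    ext i j
    simp only [Matrix.mul_apply, hmat, Matrix.of_apply, mul_ite, mul_one, mul_zero,
      Finset.sum_ite_eq', Finset.mem_univ, if_true]
    have : j - 1 - (k : ZMod n) = j - ((k + 1 : ℕ) : ZMod n) := by push_cast; ring
    simp [this]

lemma Imat_apply (n : ℕ) [NeZero n] (a : ZMod n × ZMod n) (i j : ZMod n) :
    Imat n a i j = if i = j - a.2 then ZMod.stdAddChar (a.1 * i) else 0 := by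
  have h : (ZMod.stdAddChar i : ℂ) ^ a.1.val = ZMod.stdAddChar (a.1 * i) := by
    rw [← AddChar.map_nsmul_eq_pow]
    simp
  rw [Imat, gmat, Matrix.diagonal_pow, Matrix.diagonal_mul, hmat_pow]
  simp [omC_pow, h]

lemma Imat_mul (n : ℕ) [NeZero n] (a b : ZMod n × ZMod n) :
    Imat n a * Imat n b = (ZMod.stdAddChar (a.2 * b.1) : ℂ) • Imat n (a + b) := by
  ext i j
  simp only [Matrix.mul_apply, Matrix.smul_apply, Imat_apply, smul_eq_mul]
  rw [Finset.sum_eq_single (i + a.2)]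
  · simp only [add_sub_cancel_right, if_true, Prod.fst_add, Prod.snd_add]
    have : (i + a.2 = j - b.2) ↔ (i = j - (a.2 + b.2)) := by
      rw [eq_sub_iff_add_eq, eq_sub_iff_add_eq, add_assoc]
    simp only [this, mul_ite, mul_zero, ← AddChar.map_add_eq_mul]
    congr 2
    ring
  · intro k _ hk
    rw [if_neg, zero_mul]
    intro h
    apply hk
    rw [h]; ring
  · simp

lemma Imat_zero (n : ℕ) [NeZero n] : Imat n 0 = 1 := by
  ext i j
  simp [Imat_apply, Matrix.one_apply]

lemma chi_ne (n : ℕ) [NeZero n] (a : ZMod n) : (ZMod.stdAddChar a : ℂ) ≠ 0 :=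
  (AddChar.val_isUnit ZMod.stdAddChar a).ne_zero

lemma Imat_mul_inv (n : ℕ) [NeZero n] (a : ZMod n × ZMod n) : Imat n a * (Imat n a)⁻¹ = 1 := by
  have h : Imat n a * ((ZMod.stdAddChar (a.2 * (-a).1) : ℂ)⁻¹ • Imat n (-a)) = 1 := by
    rw [Matrix.mul_smul, Imat_mul, smul_smul, inv_mul_cancel₀ (chi_ne n _), one_smul,
      add_neg_cancel, Imat_zero]
  rw [Matrix.inv_eq_right_inv h, h]

lemma Imat_inv_mul (n : ℕ) [NeZero n] (a : ZMod n × ZMod n) : (Imat n a)⁻¹ * Imat n a = 1 :=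
  mul_eq_one_comm.mp (Imat_mul_inv n a)

lemma Imat_add (n : ℕ) [NeZero n] (a b : ZMod n × ZMod n) : ∃ c : ℂ, c ≠ 0 ∧
    Imat n (a + b) = c • (Imat n b * Imat n a) ∧
    (Imat n (a + b))⁻¹ = c⁻¹ • ((Imat n a)⁻¹ * (Imat n b)⁻¹) := by
  refine ⟨(ZMod.stdAddChar (b.2 * a.1) : ℂ)⁻¹, inv_ne_zero (chi_ne n _), ?_, ?_⟩
  · rw [Imat_mul, smul_smul, inv_mul_cancel₀ (chi_ne n _), one_smul, add_comm]
  · rw [inv_inv]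
    have h := Imat_mul n b a
    apply Matrix.inv_eq_right_inv
    rw [Matrix.mul_smul, ← Matrix.smul_mul, add_comm a b, ← h, Matrix.mul_assoc,
      ← Matrix.mul_assoc (Imat n a), Imat_mul_inv, Matrix.one_mul, Imat_mul_inv]

lemma Imat_neg (n : ℕ) [NeZero n] (a : ZMod n × ZMod n) : ∃ c : ℂ, c ≠ 0 ∧
    Imat n (-a) = c • (Imat n a)⁻¹ ∧ (Imat n (-a))⁻¹ = c⁻¹ • Imat n a := by
  have h := Imat_mul n a (-a)
  rw [add_neg_cancel, Imat_zero] at h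
  have h1 : Imat n (-a) = (ZMod.stdAddChar (a.2 * (-a).1) : ℂ) • (Imat n a)⁻¹ := by
    have := congrArg (fun M => (Imat n a)⁻¹ * M) h
    simp only [← Matrix.mul_assoc, Imat_inv_mul, Matrix.one_mul, Matrix.mul_smul,
      Matrix.mul_one] at this
    exact this
  refine ⟨_, chi_ne n _, h1, ?_⟩
  apply Matrix.inv_eq_left_inv
  rw [Matrix.smul_mul, h, smul_smul, inv_mul_cancel₀ (chi_ne n _), one_smul]

/-- index type of the triple tensor product -/
abbrev T3 (n : ℕ) := ZMod n × ZMod n × ZMod n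

/-- basis operator on factors 1, 2 -/
def E12 (n : ℕ) [NeZero n] (a : ZMod n × ZMod n) : Matrix (T3 n) (T3 n) ℂ :=
  Imat n a ⊗ₖ ((Imat n a)⁻¹ ⊗ₖ (1 : Matrix (ZMod n) (ZMod n) ℂ))
/-- basis operator on factors 1, 3 -/
def E13 (n : ℕ) [NeZero n] (a : ZMod n × ZMod n) : Matrix (T3 n) (T3 n) ℂ :=
  Imat n a ⊗ₖ ((1 : Matrix (ZMod n) (ZMod n) ℂ) ⊗ₖ (Imat n a)⁻¹)
/-- basis operator on factors 2, 3 -/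
def E23 (n : ℕ) [NeZero n] (a : ZMod n × ZMod n) : Matrix (T3 n) (T3 n) ℂ :=
  (1 : Matrix (ZMod n) (ZMod n) ℂ) ⊗ₖ (Imat n a ⊗ₖ (Imat n a)⁻¹)

lemma E_rel1 (n : ℕ) [NeZero n] (a b : ZMod n × ZMod n) :
    E13 n a * E23 n b = E23 n (a + b) * E12 n a := by
  obtain ⟨c, hc, h1, h2⟩ := Imat_add n a b
  simp only [E13, E23, E12, ← Matrix.mul_kronecker_mul, Matrix.one_mul, Matrix.mul_one]
  rw [h2, h1, Matrix.smul_mul, Matrix.mul_assoc, Imat_mul_inv, Matrix.mul_one,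
    Matrix.smul_kronecker]
  simp only [Matrix.smul_kronecker, Matrix.kronecker_smul, smul_smul]
  rw [mul_inv_cancel₀ hc, one_smul]

lemma E_rel2 (n : ℕ) [NeZero n] (a b : ZMod n × ZMod n) :
    E13 n a * E23 n b = E12 n (-b) * E13 n (a + b) := by
  obtain ⟨c, hc, h1, h2⟩ := Imat_add n a b
  obtain ⟨d, hd, h3, h4⟩ := Imat_neg n b
  simp only [E13, E23, E12, ← Matrix.mul_kronecker_mul, Matrix.one_mul, Matrix.mul_one]
  rw [h2, h1, h4, h3, Matrix.smul_mul, Matrix.mul_smul, ← Matrix.mul_assoc, Imat_inv_mul,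
    Matrix.one_mul]
  simp only [Matrix.smul_kronecker, Matrix.kronecker_smul, smul_smul]
  rw [show (c⁻¹ * d⁻¹ * (d * c)) = 1 by field_simp, one_smul]

lemma E_rel3 (n : ℕ) [NeZero n] (a b : ZMod n × ZMod n) :
    E23 n a * E13 n b = E12 n b * E23 n (a + b) := by
  obtain ⟨c, hc, h1, h2⟩ := Imat_add n a b
  simp only [E13, E23, E12, ← Matrix.mul_kronecker_mul, Matrix.one_mul, Matrix.mul_one]
  rw [h2, h1, Matrix.mul_smul, ← Matrix.mul_assoc, Imat_inv_mul, Matrix.one_mul]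
  simp only [Matrix.smul_kronecker, Matrix.kronecker_smul, smul_smul]
  rw [inv_mul_cancel₀ hc, one_smul]

lemma E_rel4 (n : ℕ) [NeZero n] (a b : ZMod n × ZMod n) :
    E23 n a * E13 n b = E13 n (a + b) * E12 n (-a) := by
  obtain ⟨c, hc, h1, h2⟩ := Imat_add n a b
  obtain ⟨d, hd, h3, h4⟩ := Imat_neg n a
  simp only [E13, E23, E12, ← Matrix.mul_kronecker_mul, Matrix.one_mul, Matrix.mul_one]
  rw [h2, h1, h4, h3, Matrix.smul_mul, Matrix.mul_smul, Matrix.mul_assoc, Imat_mul_inv,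
    Matrix.mul_one]
  simp only [Matrix.smul_kronecker, Matrix.kronecker_smul, smul_smul]
  rw [show (c⁻¹ * d⁻¹ * (c * d)) = 1 by field_simp, one_smul]

lemma E12_mul (n : ℕ) [NeZero n] (a b : ZMod n × ZMod n) :
    E12 n a * E12 n b = psi n a b • E12 n (a + b) := by
  have h : (Imat n a)⁻¹ * (Imat n b)⁻¹ =
      (ZMod.stdAddChar (b.2 * a.1) : ℂ)⁻¹ • (Imat n (a + b))⁻¹ := by
    have h1 := Imat_mul n b a
    rw [← Matrix.mul_inv_rev, h1, add_comm b a]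
    apply Matrix.inv_eq_right_inv
    rw [Matrix.smul_mul, Matrix.mul_smul, smul_smul, mul_inv_cancel₀ (chi_ne n _), one_smul,
      Imat_mul_inv]
  simp only [E12, ← Matrix.mul_kronecker_mul, Matrix.one_mul, Matrix.mul_one]
  rw [h, Imat_mul]
  simp only [Matrix.smul_kronecker, Matrix.kronecker_smul, smul_smul]
  congr 1
  rw [psi, AddChar.map_sub_eq_div, div_eq_mul_inv, mul_comm b.2]
  exact mul_comm _ _

lemma E12_zero (n : ℕ) [NeZero n] : E12 n 0 = 1 := by
  simp [E12, Imat_zero]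

/-- linear combination -/
def lc (n : ℕ) [NeZero n] (E : ZMod n × ZMod n → Matrix (T3 n) (T3 n) ℂ)
    (f : ZMod n × ZMod n → ℂ) : Matrix (T3 n) (T3 n) ℂ := ∑ a, f a • E a

lemma lc_mul (n : ℕ) [NeZero n] (E F : ZMod n × ZMod n → Matrix (T3 n) (T3 n) ℂ)
    (f g : ZMod n × ZMod n → ℂ) :
    lc n E f * lc n F g = ∑ a, ∑ b, (f a * g b) • (E a * F b) := by
  simp only [lc, Finset.sum_mul_sum, smul_mul_smul_comm]

lemma ybe_alg (n : ℕ) [NeZero n] (f fm g g2 h h2 : ZMod n × ZMod n → ℂ) (s t u κ : ℂ) (hs : s ≠ 0)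
    (fay : ∀ a b, s * (g a * h b) = t * (h2 (a + b) * f a) - u * (fm (-b) * g2 (a + b)))
    (u1 : lc n (E12 n) f * lc n (E12 n) fm = κ • 1)
    (u2 : lc n (E12 n) fm * lc n (E12 n) f = κ • 1) :
    lc n (E12 n) f * lc n (E13 n) g * lc n (E23 n) h =
      lc n (E23 n) h * lc n (E13 n) g * lc n (E12 n) f := by
  have r1 : s • (lc n (E13 n) g * lc n (E23 n) h) =
      t • (lc n (E23 n) h2 * lc n (E12 n) f) - u • (lc n (E12 n) fm * lc n (E13 n) g2) := by
    have e1 : lc n (E23 n) h2 * lc n (E12 n) f =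
        ∑ a, ∑ b, (h2 (a + b) * f a) • (E13 n a * E23 n b) := by
      rw [lc_mul, Finset.sum_comm]
      refine Finset.sum_congr rfl fun a _ => ?_
      rw [← Equiv.sum_comp (Equiv.addLeft a)]
      refine Finset.sum_congr rfl fun b _ => ?_
      rw [E_rel1, Equiv.coe_addLeft]
    have e2 : lc n (E12 n) fm * lc n (E13 n) g2 =
        ∑ a, ∑ b, (fm (-b) * g2 (a + b)) • (E13 n a * E23 n b) := by
      rw [lc_mul, Finset.sum_comm (γ := ZMod n × ZMod n) (s := Finset.univ) (t := Finset.univ)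
        (f := fun a b => (fm (-b) * g2 (a + b)) • (E13 n a * E23 n b)),
        ← Equiv.sum_comp (Equiv.neg _)]
      refine Finset.sum_congr rfl fun b _ => ?_
      rw [← Equiv.sum_comp (Equiv.addRight b)]
      refine Finset.sum_congr rfl fun a _ => ?_
      rw [E_rel2, Equiv.coe_addRight, Equiv.neg_apply]
    rw [lc_mul, e1, e2]
    simp only [Finset.smul_sum, smul_smul, ← Finset.sum_sub_distrib, ← sub_smul, fay]
  have r2 : s • (lc n (E23 n) h * lc n (E13 n) g) =
      t • (lc n (E12 n) f * lc n (E23 n) h2) - u • (lc n (E13 n) g2 * lc n (E12 n) fm) := by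
    have e1 : lc n (E12 n) f * lc n (E23 n) h2 =
        ∑ a, ∑ b, (h2 (a + b) * f a) • (E23 n b * E13 n a) := by
      rw [lc_mul]
      refine Finset.sum_congr rfl fun a _ => ?_
      rw [← Equiv.sum_comp (Equiv.addLeft a)]
      refine Finset.sum_congr rfl fun b _ => ?_
      rw [E_rel3, Equiv.coe_addLeft, mul_comm, add_comm b a]
    have e2 : lc n (E13 n) g2 * lc n (E12 n) fm =
        ∑ a, ∑ b, (fm (-b) * g2 (a + b)) • (E23 n b * E13 n a) := by
      rw [lc_mul, Finset.sum_comm, Finset.sum_comm (γ := ZMod n × ZMod n) (s := Finset.univ) (t := Finset.univ)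
        (f := fun a b => (fm (-b) * g2 (a + b)) • (E23 n b * E13 n a)),
        ← Equiv.sum_comp (Equiv.neg _)]
      refine Finset.sum_congr rfl fun b _ => ?_
      rw [← Equiv.sum_comp (Equiv.addRight b)]
      refine Finset.sum_congr rfl fun a _ => ?_
      rw [E_rel4, Equiv.coe_addRight, Equiv.neg_apply, mul_comm, add_comm b a]
    rw [lc_mul, Finset.sum_comm, e1, e2]
    simp only [Finset.smul_sum, smul_smul, ← Finset.sum_sub_distrib, ← sub_smul, ← fay]
    simp only [mul_comm (h _)]
  apply smul_right_injective _ hs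
  simp only
  rw [← Matrix.smul_mul s (lc n (E23 n) h * lc n (E13 n) g), r2,
    Matrix.mul_assoc, ← Matrix.mul_smul, r1, Matrix.mul_sub,
    Matrix.sub_mul, Matrix.mul_smul, Matrix.mul_smul, Matrix.smul_mul, Matrix.smul_mul,
    ← Matrix.mul_assoc, ← Matrix.mul_assoc, u1, Matrix.mul_assoc (lc n (E13 n) g2), u2]
  simp

lemma unit_lc (n : ℕ) [NeZero n] (τ : ℂ) (hτ : 0 < τ.im) (ħ z : ℂ)
    (h1 : ∀ a, bTh τ (ħ + bS n τ a) ≠ 0) :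
    lc n (E12 n) (wM n τ ħ z) * lc n (E12 n) (wM n τ (-ħ) z) =
      (∑ a, wM n τ ħ z a * wM n τ (-ħ) z (-a)) • 1 := by
  rw [lc_mul]
  have : ∀ a, ∑ b, (wM n τ ħ z a * wM n τ (-ħ) z b) • (E12 n a * E12 n b) =
      ∑ A, (psi n a A * (wM n τ ħ z a * wM n τ (-ħ) z (A - a))) • E12 n A := by
    intro a
    rw [← Equiv.sum_comp (Equiv.subRight a)]
    refine Finset.sum_congr rfl fun A _ => ?_
    rw [E12_mul, smul_smul, Equiv.subRight_apply, add_sub_cancel, mul_comm]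
    congr 2
    simp only [psi, Prod.fst_sub, Prod.snd_sub]
    congr 1
    ring
  simp only [this]
  rw [Finset.sum_comm]
  simp only [← Finset.sum_smul]
  rw [Finset.sum_eq_single 0]
  · rw [E12_zero]
    simp [psi]
  · intro A _ hA
    rw [unit_M n τ hτ ħ z h1 A hA, zero_smul]
  · simp


lemma bTh_all (n : ℕ) [NeZero n] (τ ħ : ℂ)
    (h : ∀ a : ZMod n × ZMod n, bTh τ (ħ + bS n τ (rp n a)) ≠ 0) (a : ℤ × ℤ) :
    bTh τ (ħ + bS n τ a) ≠ 0 := by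
  classical
  set F : ℤ × ℤ → ℂ := fun a => if bTh τ (ħ + bS n τ a) = 0 then 1 else 0 with hF
  have p1 : Function.Periodic F ((n : ℤ), 0) := by
    intro b
    simp only [hF]
    rw [bS_add, bS_one, ← add_assoc]
    have := bTh_eq_zero_add_tau τ (ħ + bS n τ b + -τ)
    rw [neg_add_cancel_right] at this
    simp only [this]
  have p2 : Function.Periodic F (0, (n : ℤ)) := by
    intro b
    simp only [hF]
    rw [bS_add, bS_two, ← add_assoc]
    simp only [bTh_eq_zero_add_one]
  have e := per_eq n F p1 p2 a (rp n ((a.1 : ZMod n), (a.2 : ZMod n))) (by simp [rp]) (by simp [rp])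
  simp only [hF] at e
  rw [if_neg (h _)] at e
  intro h0
  simp [h0] at e

lemma ybe_generic (n : ℕ) [NeZero n] (τ : ℂ) (hτ : 0 < τ.im) (ħ z w : ℂ)
    (h1 : ∀ a, bTh τ (ħ + bS n τ a) ≠ 0) (h2 : ∀ a, bTh τ (2 * ħ + bS n τ a) ≠ 0)
    (hz : bTh τ z ≠ 0) :
    lc n (E12 n) (wM n τ ħ z) * lc n (E13 n) (wM n τ ħ (z + w)) * lc n (E23 n) (wM n τ ħ w) =
    lc n (E23 n) (wM n τ ħ w) * lc n (E13 n) (wM n τ ħ (z + w)) * lc n (E12 n) (wM n τ ħ z) := by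
  have h1n : ∀ a, bTh τ (-ħ + bS n τ a) ≠ 0 := by
    intro a
    have := h1 (-a)
    rw [bS_neg, show ħ + -bS n τ a = -(-ħ + bS n τ a) by ring, bTh_neg] at this
    exact neg_ne_zero.mp this
  refine ybe_alg n _ (wM n τ (-ħ) z) _ (wM n τ (2 * ħ) (z + w)) _ (wM n τ (2 * ħ) w)
    _ _ _ _ hz (fun a b => fay_M n τ hτ ħ z w a b h1 h2) (unit_lc n τ hτ ħ z h1) ?_
  have := unit_lc n τ hτ (-ħ) z h1n
  rw [neg_neg] at this
  rw [this]
  congr 1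
  rw [← Equiv.sum_comp (Equiv.neg _)]
  refine Finset.sum_congr rfl fun a _ => ?_
  simp [mul_comm]

lemma lc_cont (n : ℕ) [NeZero n] (τ : ℂ) (hτ : 0 < τ.im) (ħ z c : ℂ)
    (E : ZMod n × ZMod n → Matrix (T3 n) (T3 n) ℂ)
    (h : ∀ a : ZMod n × ZMod n, bTh τ (ħ + bS n τ (rp n a)) ≠ 0) :
    ContinuousAt (fun s : ℂ => lc n E (wM n τ (ħ + s) (z + c * s))) 0 := by
  have hc := (bTh_diff τ hτ).continuous
  unfold lc
  refine tendsto_finsetSum _ fun a _ => ?_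
  refine ContinuousAt.smul (f := fun s => wM n τ (ħ + s) (z + c * s) a) ?_ continuousAt_const
  unfold wM wZ
  refine ContinuousAt.mul (by fun_prop) (ContinuousAt.div (by fun_prop) (by fun_prop) ?_)
  rw [add_zero]
  exact h a

lemma ybe_all (n : ℕ) [NeZero n] (τ : ℂ) (hτ : 0 < τ.im) (ħ z w : ℂ)
    (h : ∀ a : ZMod n × ZMod n, bTh τ (ħ + bS n τ (rp n a)) ≠ 0) :
    lc n (E12 n) (wM n τ ħ z) * lc n (E13 n) (wM n τ ħ (z + w)) * lc n (E23 n) (wM n τ ħ w) =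
    lc n (E23 n) (wM n τ ħ w) * lc n (E13 n) (wM n τ ħ (z + w)) * lc n (E12 n) (wM n τ ħ z) := by
  have h0 : ∃ z, bTh τ z ≠ 0 := ⟨_, h 0⟩
  have key : ∀ c d : ℂ, d ≠ 0 → ∀ᶠ s in nhdsWithin (0 : ℂ) {0}ᶜ, bTh τ (c + d * s) ≠ 0 := by
    intro c d hd
    have ht : Filter.Tendsto (fun s : ℂ => c + d * s) (nhdsWithin 0 {0}ᶜ) (nhdsWithin c {c}ᶜ) := by
      apply tendsto_nhdsWithin_of_tendsto_nhds_of_eventually_within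
      · have : ContinuousAt (fun s : ℂ => c + d * s) 0 := by fun_prop
        have h2 := this.tendsto
        simp only [mul_zero, add_zero] at h2
        exact h2.mono_left nhdsWithin_le_nhds
      · filter_upwards [self_mem_nhdsWithin] with s hs
        simpa [hd] using hs
    exact ht.eventually (bTh_ne_ev τ hτ h0 c)
  have c12 := lc_cont n τ hτ ħ z 1 (E12 n) h
  have c13 := lc_cont n τ hτ ħ (z + w) 2 (E13 n) h
  have c23 := lc_cont n τ hτ ħ w 1 (E23 n) h
  have L := ((c12.mul c13).mul c23).tendsto.mono_left (nhdsWithin_le_nhds (s := {0}ᶜ))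
  have R := ((c23.mul c13).mul c12).tendsto.mono_left (nhdsWithin_le_nhds (s := {0}ᶜ))
  have ev : ∀ᶠ s in nhdsWithin (0 : ℂ) {0}ᶜ,
      ((fun s : ℂ => lc n (E12 n) (wM n τ (ħ + s) (z + 1 * s))) *
      (fun s : ℂ => lc n (E13 n) (wM n τ (ħ + s) (z + w + 2 * s))) *
      (fun s : ℂ => lc n (E23 n) (wM n τ (ħ + s) (w + 1 * s)))) s =
      ((fun s : ℂ => lc n (E23 n) (wM n τ (ħ + s) (w + 1 * s))) *
      (fun s : ℂ => lc n (E13 n) (wM n τ (ħ + s) (z + w + 2 * s))) *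
      (fun s : ℂ => lc n (E12 n) (wM n τ (ħ + s) (z + 1 * s)))) s := by
    have k1 := Filter.eventually_all.mpr fun a : ZMod n × ZMod n =>
      key (ħ + bS n τ (rp n a)) 1 one_ne_zero
    have k2 := Filter.eventually_all.mpr fun a : ZMod n × ZMod n =>
      key (2 * ħ + bS n τ (rp n a)) 2 two_ne_zero
    filter_upwards [k1, k2, key z 1 one_ne_zero] with s s1 s2 s3
    have g := ybe_generic n τ hτ (ħ + s) (z + 1 * s) (w + 1 * s)
      (bTh_all n τ (ħ + s) fun a => by
        rw [show ħ + s + bS n τ (rp n a) = ħ + bS n τ (rp n a) + 1 * s by ring]; exact s1 a)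
      (bTh_all n τ (2 * (ħ + s)) fun a => by
        rw [show 2 * (ħ + s) + bS n τ (rp n a) = 2 * ħ + bS n τ (rp n a) + 2 * s by ring]
        exact s2 a) s3
    rw [show z + 1 * s + (w + 1 * s) = z + w + 2 * s by ring] at g
    exact g
  have fin := tendsto_nhds_unique_of_eventuallyEq L R ev
  simpa using fin

lemma coef_eq (n : ℕ) [NeZero n] (τ ħ z : ℂ) (a : ZMod n × ZMod n) :
    jTheta (1 / 2 - (a.1.val : ℝ) / n) (1 / 2 + (a.2.val : ℝ) / n) (ħ + z) τ /
      jTheta (1 / 2 - (a.1.val : ℝ) / n) (1 / 2 + (a.2.val : ℝ) / n) ħ τ = wM n τ ħ z a := by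
  unfold jTheta
  rw [jTheta_eq, jTheta_eq, mul_div_mul_comm, ← Complex.exp_sub, wM, wZ, bS]
  push_cast
  congr 2
  ring

lemma den_ne (n : ℕ) [NeZero n] (τ ħ : ℂ) (a : ZMod n × ZMod n)
    (h : jTheta (1 / 2 - (a.1.val : ℝ) / n) (1 / 2 + (a.2.val : ℝ) / n) ħ τ ≠ 0) :
    bTh τ (ħ + bS n τ (rp n a)) ≠ 0 := by
  unfold jTheta at h
  rw [jTheta_eq] at h
  have := right_ne_zero_of_mul h
  rw [bS, rp]
  push_cast at this ⊢
  exact this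

lemma Rbar_eq (n : ℕ) [NeZero n] (ε r : ℝ) (v : ℂ) : Rbar n ε r v = ((n : ℂ))⁻¹ •
    ∑ a : ZMod n × ZMod n, wM n ((Real.pi : ℂ) * Complex.I / ((ε : ℂ) * (r : ℂ)))
      (1 / ((n : ℂ) * (r : ℂ))) (-(v / r)) a • (Imat n a ⊗ₖ (Imat n a)⁻¹) := by
  unfold Rbar
  congr 1
  refine Finset.sum_congr rfl fun a _ => ?_
  rw [← coef_eq, ← sub_eq_add_neg (1 / ((n : ℂ) * (r : ℂ)))]

lemma R12_eq (n : ℕ) [NeZero n] (ε r : ℝ) (v : ℂ) : R12 n ε r v = ((n : ℂ))⁻¹ •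
    lc n (E12 n) (wM n ((Real.pi : ℂ) * Complex.I / ((ε : ℂ) * (r : ℂ)))
      (1 / ((n : ℂ) * (r : ℂ))) (-(v / r))) := by
  ext p q
  simp only [R12, Rbar_eq, lc, E12, Matrix.of_apply, Matrix.smul_apply, Matrix.sum_apply,
    Matrix.kroneckerMap_apply, Matrix.one_apply, smul_eq_mul, mul_assoc, Finset.sum_mul]

lemma R13_eq (n : ℕ) [NeZero n] (ε r : ℝ) (v : ℂ) : R13 n ε r v = ((n : ℂ))⁻¹ •
    lc n (E13 n) (wM n ((Real.pi : ℂ) * Complex.I / ((ε : ℂ) * (r : ℂ)))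
      (1 / ((n : ℂ) * (r : ℂ))) (-(v / r))) := by
  ext p q
  simp only [R13, Rbar_eq, lc, E13, Matrix.of_apply, Matrix.smul_apply, Matrix.sum_apply,
    Matrix.kroneckerMap_apply, Matrix.one_apply, smul_eq_mul, mul_assoc, Finset.sum_mul]
  congr 1
  refine Finset.sum_congr rfl fun a _ => ?_
  ring

lemma R23_eq (n : ℕ) [NeZero n] (ε r : ℝ) (v : ℂ) : R23 n ε r v = ((n : ℂ))⁻¹ •
    lc n (E23 n) (wM n ((Real.pi : ℂ) * Complex.I / ((ε : ℂ) * (r : ℂ)))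
      (1 / ((n : ℂ) * (r : ℂ))) (-(v / r))) := by
  ext p q
  simp only [R23, Rbar_eq, lc, E23, Matrix.of_apply, Matrix.smul_apply, Matrix.sum_apply,
    Matrix.kroneckerMap_apply, Matrix.one_apply, smul_eq_mul, mul_assoc, Finset.sum_mul]
  congr 1
  refine Finset.sum_congr rfl fun a _ => ?_
  ring

/-- Yang–Baxter equation for Belavin's `R̄`-matrix, at spectral parameters where all
factors are defined (the theta-function denominators do not vanish). -/
theorem belavin_yang_baxter (n : ℕ) [NeZero n] (hn : 2 ≤ n) (ε r : ℝ)
    (hε : 0 < ε) (hr : 1 < r) (v₁ v₂ v₃ : ℂ)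
    (hdef : ∀ α : ZMod n × ZMod n,
      jTheta (1 / 2 - (α.1.val : ℝ) / n) (1 / 2 + (α.2.val : ℝ) / n)
        (1 / ((n : ℂ) * (r : ℂ))) ((Real.pi : ℂ) * Complex.I / ((ε : ℂ) * (r : ℂ))) ≠ 0) :
    R12 n ε r (v₁ - v₂) * R13 n ε r (v₁ - v₃) * R23 n ε r (v₂ - v₃) =
      R23 n ε r (v₂ - v₃) * R13 n ε r (v₁ - v₃) * R12 n ε r (v₁ - v₂) := by
  have hτ : 0 < ((Real.pi : ℂ) * Complex.I / ((ε : ℂ) * (r : ℂ))).im := by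
    have e : (Real.pi : ℂ) * Complex.I / ((ε : ℂ) * (r : ℂ)) =
        ((Real.pi / (ε * r) : ℝ) : ℂ) * Complex.I := by
      push_cast; ring
    rw [e, Complex.im_ofReal_mul, Complex.I_im, mul_one]
    have : 0 < r := by linarith
    have := Real.pi_pos
    positivity
  have Y := ybe_all n _ hτ (1 / ((n : ℂ) * (r : ℂ))) (-((v₁ - v₂) / r)) (-((v₂ - v₃) / r))
    (fun a => den_ne n _ _ a (hdef a))
  rw [show -((v₁ - v₂) / (r : ℂ)) + -((v₂ - v₃) / r) = -((v₁ - v₃) / r) by ring] at Y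
  rw [R12_eq, R13_eq, R23_eq]
  simp only [Matrix.smul_mul, Matrix.mul_smul]
  rw [Y]

end
end
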